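/- arXiv:1807.08853 — 2 statements merged into one kernel-verified Lean document; each statement's English description precedes it below -/
import Mathlib

section
/- Let S = {(0,1),(−1,0),(1,−1)} (Model 17). Then the interacting generating function G_S(t;a,1) ∈ ℚ[a][[t]], counting loops by length and visits to the horizontal boundary only, is D-finite. -/
open PowerSeries

/-- A quarter-plane loop of length `n` with steps in `S`: a sequence of points of
`ℤ≥0 × ℤ≥0` (encoded as `ℕ × ℕ`) starting and ending at the origin, with successive
differences in `S`. -/
def IsQPLoop (S : Set (ℤ × ℤ)) (n : ℕ) (w : Fin (n + 1) → ℕ × ℕ) : Prop :=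
  w 0 = (0, 0) ∧ w (Fin.last n) = (0, 0) ∧
    ∀ i : Fin n, (((w i.succ).1 : ℤ) - ((w i.castSucc).1 : ℤ),
      ((w i.succ).2 : ℤ) - ((w i.castSucc).2 : ℤ)) ∈ S

/-- The number of visits of `w` to the horizontal boundary: indices `1 ≤ i ≤ n`
with the second coordinate of `w i` equal to `0`. -/
def hvisits {n : ℕ} (w : Fin (n + 1) → ℕ × ℕ) : ℕ :=
  (Finset.univ.filter fun i : Fin (n + 1) => 0 < (i : ℕ) ∧ (w i).2 = 0).card

/-- The number of visits of `w` to the vertical boundary: indices `1 ≤ i ≤ n`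
with the first coordinate of `w i` equal to `0`. -/
def vvisits {n : ℕ} (w : Fin (n + 1) → ℕ × ℕ) : ℕ :=
  (Finset.univ.filter fun i : Fin (n + 1) => 0 < (i : ℕ) ∧ (w i).1 = 0).card

/-- The interacting generating function `G_S(t;a,b) = Σ_n t^n Σ_w a^(h(w)) b^(v(w))`,
the inner sum over all quarter-plane loops of length `n` with steps in `S`. -/
noncomputable def loopGF (S : Set (ℤ × ℤ)) {R : Type*} [CommRing R] (a b : R) :
    PowerSeries R :=
  PowerSeries.mk fun n =>
    ∑ᶠ w : {w : Fin (n + 1) → ℕ × ℕ // IsQPLoop S n w}, a ^ hvisits w.1 * b ^ vvisits w.1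

/-- A power series `F ∈ R[[t]]` is D-finite if there are polynomials `p₀, …, p_m`,
not all zero, with `Σ pᵢ · F⁽ⁱ⁾ = 0`, where `F⁽ⁱ⁾` is the `i`-th formal derivative. -/
def IsDFinite {R : Type*} [CommRing R] (F : PowerSeries R) : Prop :=
  ∃ (m : ℕ) (p : Fin (m + 1) → Polynomial R), (∃ i, p i ≠ 0) ∧
    ∑ i : Fin (m + 1), (p i : PowerSeries R) * (PowerSeries.derivativeFun)^[(i : ℕ)] F = 0


namespace Model17

/-- The steps of Model 17. -/
def steps : Set (ℤ × ℤ) := {((0:ℤ), (1:ℤ)), (-1, 0), (1, -1)}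

/-- The points of the quarter plane from which a given point is reached by one step. -/
def preds : ℕ × ℕ → Finset (ℕ × ℕ)
  | (0, 0) => {(1, 0)}
  | (0, j + 1) => {(1, j + 1), (0, j)}
  | (i + 1, 0) => {(i + 2, 0), (i, 1)}
  | (i + 1, j + 1) => {(i + 2, j + 1), (i + 1, j), (i, j + 2)}

theorem mem_preds (p q : ℕ × ℕ) :
    q ∈ preds p ↔ (((p.1 : ℤ) - (q.1 : ℤ), (p.2 : ℤ) - (q.2 : ℤ)) : ℤ × ℤ) ∈ steps := by
  obtain ⟨i, j⟩ := p
  obtain ⟨k, l⟩ := q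
  rcases i with _ | i <;> rcases j with _ | j <;>
    simp only [preds, steps, Finset.mem_insert, Finset.mem_singleton, Set.mem_insert_iff,
      Set.mem_singleton_iff, Prod.mk.injEq] <;> push_cast <;> omega

/-- The quarter-plane walks of length `n` from the origin to a given point. -/
def walks : (n : ℕ) → ℕ × ℕ → Finset (Fin (n + 1) → ℕ × ℕ)
  | 0, p => if p = (0, 0) then {fun _ => (0, 0)} else ∅
  | n + 1, p => (preds p).biUnion fun q =>
      (walks n q).image fun w => (Fin.snoc w p : Fin (n + 2) → ℕ × ℕ)

theorem mem_walks (n : ℕ) (p : ℕ × ℕ) (w : Fin (n + 1) → ℕ × ℕ) :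
    w ∈ walks n p ↔ w 0 = (0, 0) ∧ w (Fin.last n) = p ∧
      ∀ i : Fin n, (((w i.succ).1 : ℤ) - ((w i.castSucc).1 : ℤ),
        ((w i.succ).2 : ℤ) - ((w i.castSucc).2 : ℤ)) ∈ steps := by
  induction n generalizing p with
  | zero =>
    have hw : ∀ x, w x = w 0 := fun x => congrArg w (Fin.fin_one_eq_zero x)
    simp only [walks]
    split_ifs with h
    · subst h
      simp [funext_iff, hw]
    · simp only [Finset.notMem_empty, false_iff]
      rintro ⟨h0, h1, -⟩
      exact h (h1.symm.trans ((hw _).trans h0))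
  | succ n ih =>
    simp only [walks, Finset.mem_biUnion, Finset.mem_image, mem_preds, ih]
    constructor
    · rintro ⟨q, hq, w', ⟨h0, h1, h2⟩, rfl⟩
      refine ⟨?_, by simp, ?_⟩
      · rw [← Fin.castSucc_zero, Fin.snoc_castSucc, h0]
      · intro i
        refine Fin.lastCases ?_ (fun i => ?_) i
        · rw [Fin.succ_last, Fin.snoc_last, Fin.snoc_castSucc, h1]
          exact hq
        · rw [← Fin.castSucc_succ, Fin.snoc_castSucc, Fin.snoc_castSucc]
          exact h2 i
    · rintro ⟨h0, h1, h2⟩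
      refine ⟨w (Fin.last n).castSucc, ?_, Fin.init w, ⟨?_, rfl, fun i => ?_⟩, ?_⟩
      · rw [← h1, ← Fin.succ_last]
        exact h2 (Fin.last n)
      · simpa [Fin.init] using h0
      · exact h2 i.castSucc
      · rw [← h1]
        exact Fin.snoc_init_self w

theorem hvisits_snoc {n : ℕ} (w : Fin (n + 1) → ℕ × ℕ) (p : ℕ × ℕ) :
    hvisits (Fin.snoc w p : Fin (n + 2) → ℕ × ℕ) = hvisits w + if p.2 = 0 then 1 else 0 := by
  simp only [hvisits, Finset.card_filter]
  rw [Fin.sum_univ_castSucc]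
  simp

/-- The weighted number of quarter-plane walks of length `n` ending at a given point. -/
def weight {R : Type*} [CommRing R] (a : R) : ℕ → ℕ × ℕ → R
  | 0, p => if p = (0, 0) then 1 else 0
  | n + 1, p => (if p.2 = 0 then a else 1) * ∑ q ∈ preds p, weight a n q

theorem sum_walks {R : Type*} [CommRing R] (a : R) (n : ℕ) (p : ℕ × ℕ) :
    ∑ w ∈ walks n p, a ^ hvisits w = weight a n p := by
  induction n generalizing p with
  | zero =>
    simp only [walks, weight]
    split_ifs with h
    · simp [hvisits]
    · simp
  | succ n ih =>
    simp only [walks, weight]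
    rw [Finset.sum_biUnion, Finset.mul_sum]
    · refine Finset.sum_congr rfl fun q _ => ?_
      rw [Finset.sum_image, ← ih, Finset.mul_sum]
      · refine Finset.sum_congr rfl fun w _ => ?_
        rw [hvisits_snoc]
        split_ifs
        · rw [pow_succ, mul_comm]
        · simp
      · intro w _ w' _ h
        exact (Fin.snoc_inj.1 h).1
    · intro q _ q' _ hne
      simp only [Function.onFun, Finset.disjoint_left, Finset.mem_image, mem_walks]
      rintro _ ⟨w, ⟨-, h, -⟩, rfl⟩ ⟨w', ⟨-, h', -⟩, he⟩
      have := (Fin.snoc_inj.1 he).1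
      exact hne (by rw [← h, ← h', this])

theorem coeff_loopGF {R : Type*} [CommRing R] (a : R) (n : ℕ) :
    PowerSeries.coeff n (loopGF steps a 1) = weight a n (0, 0) := by
  rw [← sum_walks, loopGF, PowerSeries.coeff_mk]
  simp only [one_pow, mul_one]
  have hset : {w : Fin (n + 1) → ℕ × ℕ | IsQPLoop steps n w} = (walks n (0, 0) : Set _) := by
    ext w
    rw [Finset.mem_coe, mem_walks]
    rfl
  rw [← finsum_mem_coe_finset, ← hset]
  exact finsum_set_coe_eq_finsum_mem (f := fun w : Fin (n + 1) → ℕ × ℕ => a ^ hvisits w) _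

section weight

variable {R : Type*} [CommRing R] (a : R) (n i j : ℕ)

theorem weight_succ_zero_zero : weight a (n + 1) (0, 0) = a * weight a n (1, 0) := by
  simp [weight, preds]

theorem weight_succ_zero_succ :
    weight a (n + 1) (0, j + 1) = weight a n (1, j + 1) + weight a n (0, j) := by
  simp [weight, preds]

theorem weight_succ_succ_zero :
    weight a (n + 1) (i + 1, 0) = a * (weight a n (i + 2, 0) + weight a n (i, 1)) := by
  simp [weight, preds]

theorem weight_succ_succ_succ :
    weight a (n + 1) (i + 1, j + 1) =
      weight a n (i + 2, j + 1) + weight a n (i + 1, j) + weight a n (i, j + 2) := by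
  simp [weight, preds, add_assoc]

theorem weight_eq_zero (h : n < 2 * i + j ∨ n % 3 ≠ (2 * i + j) % 3) : weight a n (i, j) = 0 := by
  induction n generalizing i j with
  | zero =>
    rw [weight, if_neg]
    rw [Prod.mk.injEq]
    omega
  | succ n ih =>
    rcases i with _ | i <;> rcases j with _ | j
    · rw [weight_succ_zero_zero, ih _ _ (by omega), mul_zero]
    · rw [weight_succ_zero_succ, ih _ _ (by omega), ih _ _ (by omega), add_zero]
    · rw [weight_succ_succ_zero, ih _ _ (by omega), ih _ _ (by omega), add_zero, mul_zero]
    · rw [weight_succ_succ_succ, ih _ _ (by omega), ih _ _ (by omega), ih _ _ (by omega),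
        add_zero, add_zero]

/-- Removing the interaction with the boundary: the kernel relation at the level of coefficients. -/
theorem mul_weight (a : R) (n i j : ℕ) :
    a * weight a n (i, j) = (a - 1) * weight a (n + 1) (i, j + 1) + weight 1 n (i, j) := by
  induction n generalizing i j with
  | zero =>
    rcases i with _ | i <;> rcases j with _ | j <;>
      simp [weight_succ_zero_succ, weight_succ_succ_succ] <;> simp [weight]
  | succ n ih =>
    rcases i with _ | i <;> rcases j with _ | j
    · rw [weight_succ_zero_succ a (n + 1) 0, weight_succ_zero_zero, weight_succ_zero_zero]
      linear_combination ih 1 0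
    · rw [weight_succ_zero_succ a (n + 1) (j + 1), weight_succ_zero_succ a n j,
        weight_succ_zero_succ 1 n j]
      linear_combination ih 1 (j + 1) + ih 0 j + (a - 1) * weight_succ_zero_succ a n j
    · rw [weight_succ_succ_succ a (n + 1) i 0, weight_succ_succ_zero, weight_succ_succ_zero]
      linear_combination ih (i + 2) 0 + ih i 1
    · rw [weight_succ_succ_succ a (n + 1) i (j + 1), weight_succ_succ_succ a n i j,
        weight_succ_succ_succ 1 n i j]
      linear_combination ih (i + 2) (j + 1) + ih (i + 1) j + ih i (j + 2) +
        (a - 1) * weight_succ_succ_succ a n i j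

end weight

open Nat in
/-- The hook length formula for standard Young tableaux with rows of lengths `A ≥ C ≥ b`. -/
theorem weight_one_eq (N A C b i j : ℕ) (hC : C = b + i) (hA : A = C + j) (hN : N = A + C + b) :
    weight (1 : ℚ) N (i, j) =
      N ! * (i + 1) * (j + 1) * (i + j + 2) / ((A + 2)! * (C + 1)! * b !) := by
  induction N generalizing A C b i j with
  | zero =>
    obtain ⟨rfl, rfl, rfl, rfl, rfl⟩ : A = 0 ∧ C = 0 ∧ b = 0 ∧ i = 0 ∧ j = 0 := by omega
    simp [weight]
  | succ N ih =>
    have fac (n : ℕ) : ((n ! : ℕ) : ℚ) ≠ 0 := by positivity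
    have hN' : (N : ℚ) = A + C + b - 1 := by
      rw [eq_sub_iff_add_eq]
      exact_mod_cast hN
    have first : weight (1 : ℚ) N (i + 1, j) =
        N ! * (i + 2) * (j + 1) * (i + j + 3) * b / ((A + 2)! * (C + 1)! * b !) := by
      rcases b with _ | b
      · rw [weight_eq_zero _ _ _ _ (by omega)]
        simp
      · rw [ih A C b (i + 1) j (by omega) (by omega) (by omega), Nat.factorial_succ b]
        push_cast
        have := fac b; have := fac (A + 2); have := fac (C + 1)
        field_simp
        ring
    have second (k : ℕ) (hk : j = k + 1) : weight (1 : ℚ) N (i, k) =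
        N ! * (i + 1) * j * (i + j + 1) * (A + 2) / ((A + 2)! * (C + 1)! * b !) := by
      obtain ⟨B, rfl⟩ : ∃ B, A = B + 1 := ⟨A - 1, by omega⟩
      rw [ih B C b i k (by omega) (by omega) (by omega), Nat.factorial_succ (B + 2), hk]
      push_cast
      have := fac b; have := fac (B + 2); have := fac (C + 1)
      have : (B : ℚ) + 2 + 1 ≠ 0 := by positivity
      field_simp
      ring
    have third (k : ℕ) (hk : i = k + 1) : weight (1 : ℚ) N (k, j + 1) =
        N ! * i * (j + 2) * (i + j + 2) * (C + 1) / ((A + 2)! * (C + 1)! * b !) := by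
      obtain ⟨B, rfl⟩ : ∃ B, C = B + 1 := ⟨C - 1, by omega⟩
      rw [ih A B b k (j + 1) (by omega) (by omega) (by omega), Nat.factorial_succ (B + 1), hk]
      push_cast
      have := fac b; have := fac (A + 2); have := fac (B + 1)
      have : (B : ℚ) + 1 + 1 ≠ 0 := by positivity
      field_simp
      ring
    have total : weight (1 : ℚ) (N + 1) (i, j) =
        N ! * (i + 2) * (j + 1) * (i + j + 3) * b / ((A + 2)! * (C + 1)! * b !) +
        N ! * (i + 1) * j * (i + j + 1) * (A + 2) / ((A + 2)! * (C + 1)! * b !) +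
        N ! * i * (j + 2) * (i + j + 2) * (C + 1) / ((A + 2)! * (C + 1)! * b !) := by
      rw [← first]
      rcases i with _ | i <;> rcases j with _ | j
      · rw [weight_succ_zero_zero]
        simp
      · rw [weight_succ_zero_succ, ← second j rfl]
        simp
      · rw [weight_succ_succ_zero, ← third i rfl]
        simp
      · rw [weight_succ_succ_succ, ← second j rfl, ← third i rfl]
    rw [total, Nat.factorial_succ N]
    push_cast
    rw [hN', hA, hC]
    push_cast
    ring

theorem map_weight {R S : Type*} [CommRing R] [CommRing S] (φ : R →+* S) (a : R) (n : ℕ)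
    (p : ℕ × ℕ) : φ (weight a n p) = weight (φ a) n p := by
  induction n generalizing p with
  | zero => simp [weight, apply_ite φ]
  | succ n ih => simp [weight, apply_ite φ, ih]

theorem eq_zero_of_X_mul_eq (v : ℕ → Polynomial ℚ)
    (h : ∀ j, Polynomial.X * v j = (Polynomial.X - 1) * v (j + 1)) : v 0 = 0 := by
  have hk (k : ℕ) : Polynomial.X ^ k * v 0 = (Polynomial.X - 1) ^ k * v k := by
    induction k with
    | zero => simp
    | succ k ih => linear_combination Polynomial.X * ih + (Polynomial.X - 1) ^ k * h k
  have hdvd (k : ℕ) : (Polynomial.X - 1) ^ k ∣ v 0 := by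
    have hc : IsCoprime ((Polynomial.X - 1 : Polynomial ℚ) ^ k) (Polynomial.X ^ k) :=
      IsCoprime.pow ⟨-1, 1, by ring⟩
    exact hc.dvd_of_dvd_mul_left ⟨v k, hk k⟩
  by_contra h0
  have := Polynomial.natDegree_le_of_dvd (hdvd ((v 0).natDegree + 1)) h0
  rw [show (Polynomial.X - 1 : Polynomial ℚ) = Polynomial.X - Polynomial.C 1 by simp,
    Polynomial.natDegree_pow, Polynomial.natDegree_X_sub_C] at this
  omega

section telescoping

variable {A : Type*} [CommRing A] (a n j : A)

/-- The part of the telescoping certificate that belongs to the summand of index `n + 1`. -/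
def certNext : A :=
  (16 * n ^ 4 * a ^ 4 - 24 * n ^ 4 * a ^ 3 + 16 * n ^ 3 * a ^ 4 - 4 * n ^ 3 * a ^ 3 -
    4 * n ^ 2 * a ^ 4 + 36 * n ^ 2 * a ^ 3 + 2 * n ^ 2 * a ^ 2 - 4 * n * a ^ 4 + 16 * n * a ^ 3 +
    6 * n * a ^ 2 + 4 * a ^ 2) +
  (8 * n ^ 3 * a ^ 3 + 12 * n ^ 2 * a ^ 3 + 12 * n ^ 2 * a ^ 2 + 12 * n ^ 2 * a + 9 * n ^ 2 +
    4 * n * a ^ 3 + 18 * n * a ^ 2 + 16 * n * a + 9 * n + 6 * a ^ 2 + 4 * a + 2) * j +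
  (4 * n ^ 2 * a ^ 2 + 6 * n ^ 2 * a + 9 * n ^ 2 + 6 * n * a ^ 2 + 12 * n * a + 15 * n +
    2 * a ^ 2 + 6 * a + 5) * j ^ 2 +
  (2 * n * a + 6 * n + 2 * a + 4) * j ^ 3 + j ^ 4

/-- The part of the telescoping certificate that belongs to the summand of index `n`. -/
def certSelf : A :=
  (4 * n ^ 4 * a ^ 2 - 10 * n ^ 4 * a + 6 * n ^ 4 + 10 * n ^ 3 * a ^ 2 - 20 * n ^ 3 * a +
    10 * n ^ 3 + 2 * n ^ 2 * a ^ 2 + 10 * n ^ 2 * a - 10 * n ^ 2 - 4 * n * a ^ 2 + 20 * n * a -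
    10 * n + 4) +
  (2 * n ^ 3 * a - 2 * n ^ 3 + 6 * n ^ 2 * a - 3 * n ^ 2 + 4 * n * a + 5 * n + 6) * j +
  (n ^ 2 + 3 * n + 2) * j ^ 2

/-- The common factor of the two remainders left by the certificates. -/
def bracket : A := 2 * (2 * n + 1) * (a ^ 2 - 3 * a) + 3 * (3 * n + 2)

/-- The coefficient of the next term in the inhomogeneous recurrence. -/
def coeffNext : A := (n + 2) * (a - 1) * bracket a (n - 1)

/-- The coefficient of the current term in the inhomogeneous recurrence. -/
def coeffSelf : A := -2 * a ^ 3 * (2 * n - 1) * bracket a n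

/-- The polynomial factor of the right-hand side of the inhomogeneous recurrence. -/
def boundary : A := coeffNext a n * certNext a n 0 + coeffSelf a n * certSelf a n 0

theorem certNext_telescopes :
    a * certNext a n j * (n + j + 3) - (a - 1) * certNext a n (j + 1) * (3 * n + j + 1) =
      (j + 1) * (j + 2) * ((3 * n + j + 1) * (3 * n + j + 2) * (3 * n + j + 3)) -
        4 * a ^ 3 * n * (n ^ 2 - 1) * (2 * n - 1) * bracket a n := by
  simp only [certNext, bracket]
  ring

theorem certSelf_telescopes :
    a * certSelf a n j * (n + j + 3) - (a - 1) * certSelf a n (j + 1) * (3 * n + j + 1) =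
      (j + 1) * (j + 2) * ((n + 1) * (n + 2) * (n + j + 3)) -
        2 * n * (n ^ 2 - 1) * (n + 2) * (a - 1) * bracket a (n - 1) := by
  simp only [certSelf, bracket]
  ring

end telescoping

open Nat in
/-- The inhomogeneous recurrence of order one in the number of steps of each kind. -/
theorem inhomogeneous_recurrence (n : ℕ) :
    coeffNext (Polynomial.X : Polynomial ℚ) n * weight Polynomial.X (3 * (n + 1)) (0, 0) +
      coeffSelf (Polynomial.X : Polynomial ℚ) n * weight Polynomial.X (3 * n) (0, 0) =
    boundary (Polynomial.X : Polynomial ℚ) n *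
      Polynomial.C ((3 * n)! / ((n + 2)! * (n + 1)! * (n + 2)!) : ℚ) := by
  set a : Polynomial ℚ := Polynomial.X
  let s (j : ℕ) : Polynomial ℚ :=
    Polynomial.C ((3 * n + j)! / ((n + j + 2)! * (n + 1)! * (n + 2)!) : ℚ)
  let v (j : ℕ) : Polynomial ℚ :=
    coeffNext a n * weight a (3 * (n + 1) + j) (0, j) + coeffSelf a n * weight a (3 * n + j) (0, j) -
      (coeffNext a n * certNext a n j + coeffSelf a n * certSelf a n j) * s j
  have hv : v 0 = 0 := by
    refine eq_zero_of_X_mul_eq v fun j => ?_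
    let g : ℚ := (3 * n + j)! / ((n + j + 3)! * (n + 1)! * (n + 2)!)
    have fac (n : ℕ) : ((n ! : ℕ) : ℚ) ≠ 0 := by positivity
    have hp : (n : ℚ) + j + 2 + 1 ≠ 0 := by positivity
    have hp' : (n : ℚ) + 1 + 1 ≠ 0 := by positivity
    have h1 := fac (n + j + 2)
    have h2 := fac (n + 1)
    have h3 := fac n
    have hs : s j = (n + j + 3) * Polynomial.C g := by
      have : ((3 * n + j)! / ((n + j + 2)! * (n + 1)! * (n + 2)!) : ℚ) = (n + j + 3) * g := by
        simp only [g, Nat.factorial_succ (n + j + 2)]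
        push_cast
        field_simp
        ring
      simp only [s, this, map_mul, map_add, map_natCast, map_ofNat]
    have hs' : s (j + 1) = (3 * n + j + 1) * Polynomial.C g := by
      have : ((3 * n + (j + 1))! / ((n + (j + 1) + 2)! * (n + 1)! * (n + 2)!) : ℚ) =
          (3 * n + j + 1) * g := by
        simp only [g, ← add_assoc, Nat.factorial_succ (3 * n + j),
          show n + j + 1 + 2 = n + j + 3 by omega]
        push_cast
        ring
      simp only [s, this, map_mul, map_add, map_natCast, map_ofNat, map_one]
    have hw : weight (1 : Polynomial ℚ) (3 * n + j) (0, j) =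
        (j + 1) * (j + 2) * ((n + 1) * (n + 2) * (n + j + 3)) * Polynomial.C g := by
      have : weight (1 : ℚ) (3 * n + j) (0, j) =
          (j + 1) * (j + 2) * ((n + 1) * (n + 2) * (n + j + 3)) * g := by
        rw [weight_one_eq _ (n + j) n n 0 j (by omega) (by omega) (by omega)]
        simp only [g, Nat.factorial_succ (n + j + 2), Nat.factorial_succ (n + 1),
          Nat.factorial_succ n]
        push_cast
        field_simp
        ring
      rw [← map_one Polynomial.C, ← map_weight, this]
      simp only [map_mul, map_add, map_natCast, map_ofNat, map_one]
    have hw' : weight (1 : Polynomial ℚ) (3 * (n + 1) + j) (0, j) =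
        (j + 1) * (j + 2) * ((3 * n + j + 1) * (3 * n + j + 2) * (3 * n + j + 3)) *
          Polynomial.C g := by
      have : weight (1 : ℚ) (3 * (n + 1) + j) (0, j) =
          (j + 1) * (j + 2) * ((3 * n + j + 1) * (3 * n + j + 2) * (3 * n + j + 3)) * g := by
        rw [weight_one_eq _ (n + 1 + j) (n + 1) (n + 1) 0 j (by omega) (by omega) (by omega)]
        simp only [g, show 3 * (n + 1) + j = 3 * n + j + 2 + 1 by omega,
          Nat.factorial_succ (3 * n + j + 2), Nat.factorial_succ (3 * n + j + 1),
          Nat.factorial_succ (3 * n + j), show n + 1 + j + 2 = n + j + 3 by omega]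
        push_cast
        ring
      rw [← map_one Polynomial.C, ← map_weight, this]
      simp only [map_mul, map_add, map_natCast, map_ofNat, map_one]
    have hu := mul_weight a (3 * n + j) 0 j
    have hu' := mul_weight a (3 * (n + 1) + j) 0 j
    rw [hw] at hu
    rw [hw'] at hu'
    have hc := certNext_telescopes a (n : Polynomial ℚ) j
    have hc' := certSelf_telescopes a (n : Polynomial ℚ) j
    simp only [v, hs, hs', ← add_assoc] at *
    change a * _ = (a - 1) * _
    push_cast
    simp only [coeffNext, coeffSelf] at *
    linear_combination ((n : Polynomial ℚ) + 2) * (a - 1) * bracket a (n - 1) *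
      (hu' - Polynomial.C g * hc) +
      (-2 * a ^ 3 * (2 * (n : Polynomial ℚ) - 1) * bracket a n) * (hu - Polynomial.C g * hc')
  simpa [v, s, boundary, sub_eq_zero] using hv

theorem exists_eq_sum_descPochhammer {R : Type*} [CommRing R] (q : Polynomial R) :
    ∃ b : ℕ →₀ R, q = b.sum fun l r => r • descPochhammer R l := by
  suffices h : q ∈ Submodule.span R (Set.range (descPochhammer R)) by
    obtain ⟨b, hb⟩ := Finsupp.mem_span_range_iff_exists_finsupp.1 h
    exact ⟨b, hb.symm⟩
  have hX (p : Polynomial R) (hp : p ∈ Submodule.span R (Set.range (descPochhammer R))) :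
      p * Polynomial.X ∈ Submodule.span R (Set.range (descPochhammer R)) := by
    induction hp using Submodule.span_induction with
    | mem x hx =>
      obtain ⟨l, rfl⟩ := hx
      have : descPochhammer R l * Polynomial.X =
          descPochhammer R (l + 1) + (l : R) • descPochhammer R l := by
        rw [descPochhammer_succ_right, Polynomial.smul_eq_C_mul, map_natCast]
        ring
      rw [this]
      exact add_mem (Submodule.subset_span ⟨_, rfl⟩)
        (Submodule.smul_mem _ _ (Submodule.subset_span ⟨_, rfl⟩))
    | zero => simp
    | add x y _ _ hx hy => rw [add_mul]; exact add_mem hx hy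
    | smul r x _ hx => rw [smul_mul_assoc]; exact Submodule.smul_mem _ _ hx
  induction q using Polynomial.induction_on' with
  | add p q hp hq => exact add_mem hp hq
  | monomial n r =>
    rw [← Polynomial.C_mul_X_pow_eq_monomial, ← Polynomial.smul_eq_C_mul]
    refine Submodule.smul_mem _ _ ?_
    induction n with
    | zero => exact Submodule.subset_span ⟨0, by simp⟩
    | succ n ih => rw [pow_succ]; exact hX _ ih

theorem coeff_X_pow_mul_iterate_derivative {R : Type*} [CommRing R] (F : PowerSeries R)
    (k l m : ℕ) :
    PowerSeries.coeff m (PowerSeries.X ^ (k + l) * (PowerSeries.derivative R)^[l] F) =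
      if k ≤ m then ((m - k).descFactorial l : R) * PowerSeries.coeff (m - k) F else 0 := by
  rw [PowerSeries.coeff_X_pow_mul']
  by_cases hk : k ≤ m
  · obtain ⟨r, rfl⟩ := Nat.exists_eq_add_of_le hk
    simp only [hk, if_true, Nat.add_sub_cancel_left, Nat.add_le_add_iff_left]
    split_ifs with hl
    · obtain ⟨s, rfl⟩ := Nat.exists_eq_add_of_le hl
      rw [show k + (l + s) - (k + l) = s by omega, PowerSeries.coeff_iterate_derivative,
        ← Nat.add_descFactorial_eq_ascFactorial, add_comm s l]
    · rw [Nat.descFactorial_of_lt (by omega)]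
      simp
  · rw [if_neg hk, if_neg (by omega)]

/-- A power series whose coefficients satisfy a linear recurrence with polynomial coefficients
is D-finite. -/
theorem isDFinite_of_recurrence {R : Type*} [CommRing R] (F : PowerSeries R) (K : ℕ)
    (q : ℕ → Polynomial R) (hq : ∃ k ≤ K, q k ≠ 0)
    (h : ∀ m, ∑ k ∈ Finset.range (K + 1), (if k ≤ m then
      (q k).eval ((m - k : ℕ) : R) * PowerSeries.coeff (m - k) F else 0) = 0) :
    IsDFinite F := by
  choose b hb using fun k => exists_eq_sum_descPochhammer (q k)
  let L := (Finset.range (K + 1)).sup fun k => (b k).support.sup id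
  have hL (k l : ℕ) (hk : k ≤ K) (hl : b k l ≠ 0) : l < L + 1 := by
    refine Nat.lt_succ_of_le (le_trans ?_ (Finset.le_sup (Finset.mem_range_succ_iff.2 hk)))
    exact Finset.le_sup (f := id) (Finsupp.mem_support_iff.2 hl)
  refine ⟨L, fun l => ∑ k ∈ Finset.range (K + 1), Polynomial.monomial (k + l) (b k l), ?_, ?_⟩
  · obtain ⟨k, hk, hqk⟩ := hq
    obtain ⟨l, hl⟩ : ∃ l, b k l ≠ 0 := by
      by_contra! h0
      exact hqk (by rw [hb k, show b k = 0 from Finsupp.ext h0, Finsupp.sum_zero_index])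
    refine ⟨⟨l, hL k l hk hl⟩, fun h0 => hl ?_⟩
    have := congrArg (Polynomial.coeff · (k + l)) h0
    simpa [Polynomial.finsetSum_coeff, Polynomial.coeff_monomial, Nat.lt_succ_of_le hk] using this
  · ext m
    rw [map_zero, ← h m, map_sum]
    refine (Fin.sum_univ_eq_sum_range (fun l => PowerSeries.coeff m
      (((∑ k ∈ Finset.range (K + 1), Polynomial.monomial (k + l) (b k l) : Polynomial R) :
        PowerSeries R) * (PowerSeries.derivative R)^[l] F)) (L + 1)).trans ?_
    have hcoeff (l : ℕ) : PowerSeries.coeff m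
        (((∑ k ∈ Finset.range (K + 1), Polynomial.monomial (k + l) (b k l) : Polynomial R) :
          PowerSeries R) * (PowerSeries.derivative R)^[l] F) =
        ∑ k ∈ Finset.range (K + 1), b k l * (if k ≤ m then
          ((m - k).descFactorial l : R) * PowerSeries.coeff (m - k) F else 0) := by
      rw [← Polynomial.coeToPowerSeries.ringHom_apply, map_sum, Finset.sum_mul, map_sum]
      refine Finset.sum_congr rfl fun k _ => ?_
      rw [← coeff_X_pow_mul_iterate_derivative, ← Polynomial.C_mul_X_pow_eq_monomial,
        Polynomial.coeToPowerSeries.ringHom_apply, Polynomial.coe_mul, Polynomial.coe_pow,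
        Polynomial.coe_C, Polynomial.coe_X, mul_assoc,
        PowerSeries.coeff_C_mul]
    rw [Finset.sum_congr rfl fun l _ => hcoeff l, Finset.sum_comm]
    refine Finset.sum_congr rfl fun k hk => ?_
    have heval : (q k).eval ((m - k : ℕ) : R) =
        ∑ l ∈ Finset.range (L + 1), b k l * ((m - k).descFactorial l : R) := by
      rw [hb k, Finsupp.sum_of_support_subset (s := Finset.range (L + 1))]
      · simp [Polynomial.eval_finsetSum, descPochhammer_eval_eq_descFactorial]
      · intro l hl
        exact Finset.mem_range.2
          (hL k l (Finset.mem_range_succ_iff.1 hk) (Finsupp.mem_support_iff.1 hl))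
      · simp
    split_ifs
    · rw [heval, Finset.sum_mul]
      exact Finset.sum_congr rfl fun l _ => (mul_assoc _ _ _).symm
    · simp

section recurrence

variable {A : Type*} [CommRing A] (a n : A)

/-- The factor clearing the denominators of the ratio of consecutive right-hand sides. -/
def ratioDen : A := boundary a n * ((n + 3) ^ 2 * (n + 2))

/-- The numerator of the ratio of consecutive right-hand sides. -/
def ratioNum : A := boundary a (n + 1) * ((3 * n + 1) * (3 * n + 2) * (3 * n + 3))

/-- The coefficient of the term of index `n + 2` in the homogeneous recurrence; the factor
`(n + 1) * (n + 2)` makes the recurrence valid for `n = -1` and `n = -2`. -/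
def recTwo : A := (n + 1) * (n + 2) * (ratioDen a n * coeffNext a (n + 1))

/-- The coefficient of the term of index `n + 1` in the homogeneous recurrence. -/
def recOne : A :=
  (n + 1) * (n + 2) * (ratioDen a n * coeffSelf a (n + 1) - ratioNum a n * coeffNext a n)

/-- The coefficient of the term of index `n` in the homogeneous recurrence. -/
def recZero : A := -((n + 1) * (n + 2) * (ratioNum a n * coeffSelf a n))

variable {B : Type*} [CommRing B] (φ : A →+* B)

theorem map_recTwo : φ (recTwo a n) = recTwo (φ a) (φ n) := by
  simp [recTwo, ratioDen, boundary, coeffNext, coeffSelf, certNext, certSelf, bracket, map_ofNat]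

theorem map_recOne : φ (recOne a n) = recOne (φ a) (φ n) := by
  simp [recOne, ratioDen, ratioNum, boundary, coeffNext, coeffSelf, certNext, certSelf, bracket,
    map_ofNat]

theorem map_recZero : φ (recZero a n) = recZero (φ a) (φ n) := by
  simp [recZero, ratioNum, boundary, coeffNext, coeffSelf, certNext, certSelf, bracket, map_ofNat]

end recurrence

open Nat in
/-- The homogeneous recurrence of order two in the number of steps of each kind. -/
theorem homogeneous_recurrence (n : ℕ) :
    recTwo (Polynomial.X : Polynomial ℚ) n * weight Polynomial.X (3 * (n + 2)) (0, 0) +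
      recOne (Polynomial.X : Polynomial ℚ) n * weight Polynomial.X (3 * (n + 1)) (0, 0) +
      recZero (Polynomial.X : Polynomial ℚ) n * weight Polynomial.X (3 * n) (0, 0) = 0 := by
  have h := inhomogeneous_recurrence n
  have h' := inhomogeneous_recurrence (n + 1)
  let g : ℚ := (3 * n)! / ((n + 3)! * (n + 2)! * (n + 3)!)
  have hg : ((3 * n)! / ((n + 2)! * (n + 1)! * (n + 2)!) : ℚ) = (n + 3) ^ 2 * (n + 2) * g := by
    have fac (n : ℕ) : ((n ! : ℕ) : ℚ) ≠ 0 := by positivity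
    have h1 := fac (n + 1)
    have hp : (n : ℚ) + 2 + 1 ≠ 0 := by positivity
    have hp' : (n : ℚ) + 1 + 1 ≠ 0 := by positivity
    simp only [g, Nat.factorial_succ (n + 2), Nat.factorial_succ (n + 1)]
    push_cast
    field_simp
    ring
  have hg' : ((3 * (n + 1))! / ((n + 1 + 2)! * (n + 1 + 1)! * (n + 1 + 2)!) : ℚ) =
      (3 * n + 1) * (3 * n + 2) * (3 * n + 3) * g := by
    simp only [g, show 3 * (n + 1) = 3 * n + 2 + 1 by omega, Nat.factorial_succ (3 * n + 2),
      Nat.factorial_succ (3 * n + 1), Nat.factorial_succ (3 * n),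
      show n + 1 + 2 = n + 3 by omega, show n + 1 + 1 = n + 2 by omega]
    push_cast
    ring
  rw [hg] at h
  rw [hg'] at h'
  simp only [map_mul, map_add, map_pow, map_natCast, map_ofNat, map_one, Nat.cast_add,
    Nat.cast_one, show n + 1 + 1 = n + 2 by omega] at h h'
  simp only [recTwo, recOne, recZero, ratioDen, ratioNum]
  linear_combination ((n : Polynomial ℚ) + 1) * (n + 2) *
    (boundary Polynomial.X (n : Polynomial ℚ) * ((n + 3) ^ 2 * (n + 2)) * h' -
      boundary Polynomial.X (n + 1 : Polynomial ℚ) *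
        ((3 * n + 1) * (3 * n + 2) * (3 * n + 3)) * h)

/-- The third of the variable, which turns the length of a loop into the number of steps of each
kind. -/
noncomputable def third : Polynomial (Polynomial ℚ) :=
  Polynomial.C (Polynomial.C (1 / 3)) * Polynomial.X

theorem eval_third (n : ℕ) : third.eval ((3 * n : ℕ) : Polynomial ℚ) = n := by
  have : (Polynomial.C (1 / 3) * 3 : Polynomial ℚ) = 1 := by
    rw [← map_ofNat Polynomial.C, ← map_mul]
    norm_num
  rw [third, Polynomial.eval_C_mul, Polynomial.eval_X, Nat.cast_mul, ← mul_assoc]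
  exact (congrArg (· * (n : Polynomial ℚ)) this).trans (one_mul _)

/-- The coefficients of the recurrence in terms of the length of a loop. -/
noncomputable def lengthRec : ℕ → Polynomial (Polynomial ℚ)
  | 0 => recTwo (Polynomial.C Polynomial.X) (third - 2)
  | 3 => recOne (Polynomial.C Polynomial.X) (third - 1)
  | 6 => recZero (Polynomial.C Polynomial.X) third
  | _ => 0

theorem eval_lengthRec_zero (n : ℕ) : (lengthRec 0).eval ((3 * n : ℕ) : Polynomial ℚ) =
    recTwo Polynomial.X ((n : Polynomial ℚ) - 2) := by
  rw [lengthRec, ← Polynomial.coe_evalRingHom, map_recTwo, map_sub, Polynomial.coe_evalRingHom,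
    eval_third, Polynomial.eval_C, Polynomial.eval_ofNat]

theorem eval_lengthRec_three (n : ℕ) : (lengthRec 3).eval ((3 * n : ℕ) : Polynomial ℚ) =
    recOne Polynomial.X ((n : Polynomial ℚ) - 1) := by
  rw [lengthRec, ← Polynomial.coe_evalRingHom, map_recOne, map_sub, Polynomial.coe_evalRingHom,
    eval_third, Polynomial.eval_C, Polynomial.eval_one]

theorem eval_lengthRec_six (n : ℕ) : (lengthRec 6).eval ((3 * n : ℕ) : Polynomial ℚ) =
    recZero Polynomial.X (n : Polynomial ℚ) := by
  rw [lengthRec, ← Polynomial.coe_evalRingHom, map_recZero, Polynomial.coe_evalRingHom,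
    eval_third, Polynomial.eval_C]

theorem lengthRec_zero_ne_zero : lengthRec 0 ≠ 0 := by
  intro h
  have h' := eval_lengthRec_zero 2
  rw [h, Polynomial.eval_zero, Nat.cast_ofNat, sub_self] at h'
  have h2 := map_recTwo Polynomial.X 0 (Polynomial.evalRingHom (2 : ℚ))
  rw [← h', map_zero, Polynomial.coe_evalRingHom, Polynomial.eval_X] at h2
  norm_num [recTwo, ratioDen, boundary, coeffNext, coeffSelf, certNext, certSelf, bracket] at h2

theorem sum_lengthRec (m : ℕ) : ∑ k ∈ Finset.range (6 + 1), (if k ≤ m then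
    (lengthRec k).eval ((m - k : ℕ) : Polynomial ℚ) * weight Polynomial.X (m - k) (0, 0)
      else 0) = 0 := by
  have hsum : ∑ k ∈ Finset.range (6 + 1), (if k ≤ m then
      (lengthRec k).eval ((m - k : ℕ) : Polynomial ℚ) * weight Polynomial.X (m - k) (0, 0)
        else 0) =
      (lengthRec 0).eval (m : Polynomial ℚ) * weight Polynomial.X m (0, 0) +
      (if 3 ≤ m then (lengthRec 3).eval ((m - 3 : ℕ) : Polynomial ℚ) *
        weight Polynomial.X (m - 3) (0, 0) else 0) +
      (if 6 ≤ m then (lengthRec 6).eval ((m - 6 : ℕ) : Polynomial ℚ) *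
        weight Polynomial.X (m - 6) (0, 0) else 0) := by
    have h1 : lengthRec 1 = 0 := rfl
    have h2 : lengthRec 2 = 0 := rfl
    have h4 : lengthRec 4 = 0 := rfl
    have h5 : lengthRec 5 = 0 := rfl
    simp [Finset.sum_range_succ, h1, h2, h4, h5]
  rw [hsum]
  by_cases hm : m % 3 = 0
  · obtain ⟨n, rfl⟩ := Nat.dvd_of_mod_eq_zero hm
    rcases n with _ | _ | n
    · have := eval_lengthRec_zero 0
      simp [recTwo] at this
      simp [this]
    · have h0 := eval_lengthRec_zero 1
      have h3 := eval_lengthRec_three 0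
      norm_num [recTwo] at h0
      simp [recOne] at h3
      simp [h0, h3]
    · rw [if_pos (by omega), if_pos (by omega), show 3 * (n + 1 + 1) - 3 = 3 * (n + 1) by omega,
        show 3 * (n + 1 + 1) - 6 = 3 * n by omega, eval_lengthRec_zero, eval_lengthRec_three,
        eval_lengthRec_six, ← homogeneous_recurrence n]
      push_cast
      congr! 4 <;> ring
  · rw [weight_eq_zero _ _ _ _ (by omega)]
    split_ifs
    · rw [weight_eq_zero _ _ _ _ (by omega), weight_eq_zero _ _ _ _ (by omega)]
      simp
    · rw [weight_eq_zero _ _ _ _ (by omega)]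
      simp
    · omega
    · simp

end Model17

/-- Model 17: `G(t;a,1)` is D-finite. -/
theorem model17_Ga1_dfinite :
    IsDFinite (loopGF ({((0:ℤ), (1:ℤ)), (-1, 0), (1, -1)} : Set (ℤ × ℤ)) (Polynomial.X : Polynomial ℚ) 1) := by
  refine Model17.isDFinite_of_recurrence _ 6 Model17.lengthRec
    ⟨0, by omega, Model17.lengthRec_zero_ne_zero⟩ fun m => ?_
  refine (Finset.sum_congr rfl fun k _ => ?_).trans (Model17.sum_lengthRec m)
  rw [← Model17.coeff_loopGF, Model17.steps]
end

section
/- Let S = {(0,1),(−1,0),(1,−1)} (Model 17). Then the interacting generating function G_S(t;a,b) ∈ ℚ[a,b][[t]] is a ratio of D-finite series: there exist D-finite power series F, H ∈ ℚ[a,b][[t]] with H ≠ 0 such that H·G_S(t;a,b) = F. -/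
open PowerSeries

section Walks

variable {R M N : Type*} [CommRing R] [AddCommGroup M] [Module R M] [AddCommGroup N] [Module R N]

/-- The weight of a visit to the point `(i, j)`. -/
def siteWeight (a b : R) (i j : ℕ) : R :=
  (if j = 0 then a else 1) * (if i = 0 then b else 1)

/-- The sum of `g` over the points reachable in one step of Model 17. -/
def neighborSum (g : ℕ → ℕ → M) : ℕ → ℕ → M
  | 0, 0 => g 0 1
  | 0, j + 1 => g 0 (j + 2) + g 1 j
  | i + 1, 0 => g (i + 1) 1 + g i 0
  | i + 1, j + 1 => g (i + 1) (j + 2) + g i (j + 1) + g (i + 2) j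

/-- The weighted transfer operator of Model 17, acting on functions on the quadrant. -/
def transfer (a b : R) : (ℕ → ℕ → M) →ₗ[R] (ℕ → ℕ → M) where
  toFun f := neighborSum fun i j => siteWeight a b i j • f i j
  map_add' f g := by
    funext i j
    rcases i with _ | i <;> rcases j with _ | j <;> simp [neighborSum] <;> abel
  map_smul' c f := by
    funext i j
    rcases i with _ | i <;> rcases j with _ | j <;>
      simp [neighborSum, smul_smul, mul_comm c]

/-- The total weight of the walks of length `n` from `(0, 0)` that end at a point where they
pick up the value of `f`. -/
def walkSum (a b : R) (n : ℕ) : (ℕ → ℕ → M) →ₗ[R] M :=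
  (LinearMap.proj 0 ∘ₗ LinearMap.proj 0) ∘ₗ (transfer a b) ^ n

/-- The indicator function of a point of the quadrant. -/
def pointMass (R : Type*) [CommRing R] (i j : ℕ) : ℕ → ℕ → R :=
  fun x y => if x = i ∧ y = j then 1 else 0

/-- The total weight of the walks of length `n` from `(0, 0)` to `(i, j)`. -/
def walkWeight (a b : R) (n i j : ℕ) : R := walkSum a b n (pointMass R i j)

lemma walkSum_succ (a b : R) (n : ℕ) (f : ℕ → ℕ → M) :
    walkSum a b (n + 1) f = walkSum a b n (transfer a b f) := by
  simp [walkSum, pow_succ]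

lemma walkSum_zero (a b : R) (f : ℕ → ℕ → M) : walkSum a b 0 f = f 0 0 := by
  simp [walkSum]

lemma map_transfer (φ : M →ₗ[R] N) (a b : R) (f : ℕ → ℕ → M) :
    transfer a b (fun i j => φ (f i j)) = fun i j => φ (transfer a b f i j) := by
  funext i j
  rcases i with _ | i <;> rcases j with _ | j <;> simp [transfer, neighborSum]

lemma map_walkSum (φ : M →ₗ[R] N) (a b : R) (n : ℕ) (f : ℕ → ℕ → M) :
    walkSum a b n (fun i j => φ (f i j)) = φ (walkSum a b n f) := by
  induction n generalizing f with
  | zero => simp [walkSum_zero]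
  | succ n ih => rw [walkSum_succ, walkSum_succ, map_transfer, ih]

lemma walkWeight_zero (a b : R) (i j : ℕ) :
    walkWeight a b 0 i j = if i = 0 ∧ j = 0 then 1 else 0 := by
  simp [walkWeight, walkSum_zero, pointMass, eq_comm]

lemma transfer_pointMass (a b : R) (i j : ℕ) :
    transfer a b (pointMass R i j) = siteWeight a b i j • neighborSum (pointMass R i j) := by
  have h : (fun x y => siteWeight a b x y • pointMass R i j x y) =
      siteWeight a b i j • pointMass R i j := by
    funext x y
    by_cases hxy : x = i ∧ y = j
    · rw [hxy.1, hxy.2]; rfl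
    · simp [pointMass, hxy]
  funext x y
  change neighborSum (fun x y => siteWeight a b x y • pointMass R i j x y) x y = _
  rw [h]
  rcases x with _ | x <;> rcases y with _ | y <;> simp [neighborSum, mul_add]

lemma transfer_pointMass_zero_zero (a b : R) :
    transfer a b (pointMass R 0 0) = (a * b) • pointMass R 1 0 := by
  rw [transfer_pointMass, show siteWeight a b 0 0 = a * b by simp [siteWeight]]
  congr 1
  funext x y
  rcases x with _ | x <;> rcases y with _ | y <;> simp [neighborSum, pointMass]

lemma transfer_pointMass_succ_zero (a b : R) (k : ℕ) :
    transfer a b (pointMass R (k + 1) 0) = a • (pointMass R (k + 2) 0 + pointMass R k 1) := by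
  rw [transfer_pointMass, show siteWeight a b (k + 1) 0 = a by simp [siteWeight]]
  congr 1
  funext x y
  rcases x with _ | x <;> rcases y with _ | y <;> simp [neighborSum, pointMass, eq_comm]

lemma transfer_pointMass_zero_succ (a b : R) (l : ℕ) :
    transfer a b (pointMass R 0 (l + 1)) = b • (pointMass R 0 l + pointMass R 1 (l + 1)) := by
  rw [transfer_pointMass, show siteWeight a b 0 (l + 1) = b by simp [siteWeight]]
  congr 1
  funext x y
  rcases x with _ | x <;> rcases y with _ | y <;> simp [neighborSum, pointMass, eq_comm]

lemma transfer_pointMass_succ_succ (a b : R) (k l : ℕ) :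
    transfer a b (pointMass R (k + 1) (l + 1)) =
      pointMass R (k + 1) l + pointMass R (k + 2) (l + 1) + pointMass R k (l + 2) := by
  rw [transfer_pointMass, show siteWeight a b (k + 1) (l + 1) = 1 by simp [siteWeight], one_smul]
  funext x y
  rcases x with _ | x <;> rcases y with _ | y <;> simp [neighborSum, pointMass, eq_comm]

lemma walkWeight_succ_zero_zero (a b : R) (n : ℕ) :
    walkWeight a b (n + 1) 0 0 = a * b * walkWeight a b n 1 0 := by
  simp only [walkWeight, walkSum_succ, transfer_pointMass_zero_zero, map_smul, smul_eq_mul]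

lemma walkWeight_succ_succ_zero (a b : R) (n i : ℕ) :
    walkWeight a b (n + 1) (i + 1) 0 =
      a * (walkWeight a b n (i + 2) 0 + walkWeight a b n i 1) := by
  simp only [walkWeight, walkSum_succ, transfer_pointMass_succ_zero, map_smul, map_add,
    smul_eq_mul]

lemma walkWeight_succ_zero_succ (a b : R) (n j : ℕ) :
    walkWeight a b (n + 1) 0 (j + 1) =
      b * (walkWeight a b n 0 j + walkWeight a b n 1 (j + 1)) := by
  simp only [walkWeight, walkSum_succ, transfer_pointMass_zero_succ, map_smul, map_add,
    smul_eq_mul]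

lemma walkWeight_succ_succ_succ (a b : R) (n i j : ℕ) :
    walkWeight a b (n + 1) (i + 1) (j + 1) =
      walkWeight a b n (i + 1) j + walkWeight a b n (i + 2) (j + 1) +
        walkWeight a b n i (j + 2) := by
  simp only [walkWeight, walkSum_succ, transfer_pointMass_succ_succ, map_add]

lemma map_walkWeight {S : Type*} [CommRing S] (φ : R →+* S) (a b : R) (n i j : ℕ) :
    φ (walkWeight a b n i j) = walkWeight (φ a) (φ b) n i j := by
  induction n generalizing i j with
  | zero => simp [walkWeight_zero, apply_ite φ]
  | succ n ih =>
    rcases i with _ | i <;> rcases j with _ | j <;>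
      simp [walkWeight_succ_zero_zero, walkWeight_succ_succ_zero, walkWeight_succ_zero_succ,
        walkWeight_succ_succ_succ, ih]

lemma walkWeight_eq_zero_of_lt (a b : R) {n i j : ℕ} (h : n < 2 * i + j) :
    walkWeight a b n i j = 0 := by
  induction n generalizing i j with
  | zero => simp only [walkWeight_zero]; rw [if_neg (by omega)]
  | succ n ih =>
    rcases i with _ | i <;> rcases j with _ | j <;>
      simp only [walkWeight_succ_zero_zero, walkWeight_succ_succ_zero, walkWeight_succ_zero_succ,
        walkWeight_succ_succ_succ] <;>
      first
      | omega
      | ((repeat rw [ih (by omega)]); simp)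

lemma walkWeight_eq_zero_of_mod (a b : R) {n i j : ℕ} (h : n % 3 ≠ (2 * i + j) % 3) :
    walkWeight a b n i j = 0 := by
  induction n generalizing i j with
  | zero => simp only [walkWeight_zero]; rw [if_neg (by rintro ⟨rfl, rfl⟩; simp at h)]
  | succ n ih =>
    rcases i with _ | i <;> rcases j with _ | j <;>
      simp only [walkWeight_succ_zero_zero, walkWeight_succ_succ_zero, walkWeight_succ_zero_succ,
        walkWeight_succ_succ_succ] <;>
      ((repeat rw [ih (by omega)]); simp)

end Walks

section Loops

/-- The points reachable in one step of Model 17. -/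
def neighbors : ℕ × ℕ → Finset (ℕ × ℕ)
  | (0, 0) => {(0, 1)}
  | (0, j + 1) => {(0, j + 2), (1, j)}
  | (i + 1, 0) => {(i + 1, 1), (i, 0)}
  | (i + 1, j + 1) => {(i + 1, j + 2), (i, j + 1), (i + 2, j)}

lemma mem_neighbors (p q : ℕ × ℕ) :
    q ∈ neighbors p ↔ ((q.1 : ℤ) - (p.1 : ℤ), (q.2 : ℤ) - (p.2 : ℤ)) ∈
      ({((0:ℤ), (1:ℤ)), (-1, 0), (1, -1)} : Set (ℤ × ℤ)) := by
  obtain ⟨x, y⟩ := q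
  rcases p with ⟨_ | i, _ | j⟩ <;>
    simp only [neighbors, Finset.mem_insert, Finset.mem_singleton, Set.mem_insert_iff,
      Set.mem_singleton_iff, Prod.mk.injEq] <;> push_cast <;> omega

lemma sum_neighbors {M : Type*} [AddCommGroup M] (g : ℕ → ℕ → M) (p : ℕ × ℕ) :
    ∑ q ∈ neighbors p, g q.1 q.2 = neighborSum g p.1 p.2 := by
  rcases p with ⟨_ | i, _ | j⟩
  · simp [neighbors, neighborSum]
  · rw [neighbors, Finset.sum_pair (by simp)]; rfl
  · rw [neighbors, Finset.sum_pair (by simp)]; rfl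
  · rw [neighbors, Finset.sum_insert (by simp), Finset.sum_pair (by simp), ← add_assoc]; rfl

/-- The walks of Model 17 of length `n` starting at `p`. -/
def walksFrom : (n : ℕ) → ℕ × ℕ → Finset (Fin (n + 1) → ℕ × ℕ)
  | 0, p => {fun _ => p}
  | n + 1, p => (neighbors p).biUnion fun q => (walksFrom n q).image (Fin.cons p)

lemma mem_walksFrom {n : ℕ} {p : ℕ × ℕ} {w : Fin (n + 1) → ℕ × ℕ} :
    w ∈ walksFrom n p ↔ w 0 = p ∧ ∀ i : Fin n, w i.succ ∈ neighbors (w i.castSucc) := by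
  induction n generalizing p with
  | zero =>
    simp only [walksFrom, Finset.mem_singleton, IsEmpty.forall_iff, and_true]
    constructor
    · rintro rfl; rfl
    · rintro rfl; funext i; rw [Fin.eq_zero i]
  | succ n ih =>
    simp only [walksFrom, Finset.mem_biUnion, Finset.mem_image, ih, Fin.forall_fin_succ]
    constructor
    · rintro ⟨q, hq, u, ⟨rfl, hu⟩, rfl⟩
      exact ⟨rfl, hq, hu⟩
    · rintro ⟨rfl, h0, h⟩
      exact ⟨w 1, h0, Fin.tail w, ⟨rfl, h⟩, Fin.cons_self_tail w⟩

lemma hvisits_eq_sum {n : ℕ} (w : Fin (n + 1) → ℕ × ℕ) :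
    hvisits w = ∑ i : Fin n, if (w i.succ).2 = 0 then 1 else 0 := by
  rw [hvisits, Finset.card_filter, Fin.sum_univ_succ]
  simp

lemma vvisits_eq_sum {n : ℕ} (w : Fin (n + 1) → ℕ × ℕ) :
    vvisits w = ∑ i : Fin n, if (w i.succ).1 = 0 then 1 else 0 := by
  rw [vvisits, Finset.card_filter, Fin.sum_univ_succ]
  simp

lemma hvisits_cons {n : ℕ} (p : ℕ × ℕ) (w : Fin (n + 1) → ℕ × ℕ) :
    hvisits (Fin.cons p w : Fin (n + 2) → ℕ × ℕ) = (if (w 0).2 = 0 then 1 else 0) + hvisits w := by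
  rw [hvisits_eq_sum, hvisits_eq_sum]
  simp only [Fin.cons_succ]
  rw [Fin.sum_univ_succ]

lemma vvisits_cons {n : ℕ} (p : ℕ × ℕ) (w : Fin (n + 1) → ℕ × ℕ) :
    vvisits (Fin.cons p w : Fin (n + 2) → ℕ × ℕ) = (if (w 0).1 = 0 then 1 else 0) + vvisits w := by
  rw [vvisits_eq_sum, vvisits_eq_sum]
  simp only [Fin.cons_succ]
  rw [Fin.sum_univ_succ]

variable {R : Type*} [CommRing R]

lemma sum_walksFrom (a b : R) (n : ℕ) (f : ℕ → ℕ → R) (p : ℕ × ℕ) :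
    ∑ w ∈ walksFrom n p, a ^ hvisits w * b ^ vvisits w *
      f (w (Fin.last n)).1 (w (Fin.last n)).2 = (transfer a b ^ n) f p.1 p.2 := by
  induction n generalizing p with
  | zero => simp [walksFrom, hvisits_eq_sum, vvisits_eq_sum]
  | succ n ih =>
    rw [walksFrom, Finset.sum_biUnion]
    · rw [pow_succ', Module.End.mul_apply]
      change _ = neighborSum (fun i j => siteWeight a b i j • (transfer a b ^ n) f i j) p.1 p.2
      rw [← sum_neighbors]
      refine Finset.sum_congr rfl fun q _ => ?_
      rw [Finset.sum_image fun _ _ _ _ h => Fin.cons_right_injective (α := fun _ => ℕ × ℕ) p h,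
        ← ih, smul_eq_mul, Finset.mul_sum]
      refine Finset.sum_congr rfl fun w hw => ?_
      rw [hvisits_cons, vvisits_cons, (mem_walksFrom.1 hw).1, ← Fin.succ_last, Fin.cons_succ,
        siteWeight, pow_add, pow_add]
      split_ifs <;> simp <;> ring
    · intro q _ q' _ hqq'
      simp only [Function.onFun, Finset.disjoint_left, Finset.mem_image]
      rintro _ ⟨u, hu, rfl⟩ ⟨v, hv, hvu⟩
      have := Fin.cons_right_injective (α := fun _ => ℕ × ℕ) p hvu
      subst this
      exact hqq' ((mem_walksFrom.1 hu).1.symm.trans (mem_walksFrom.1 hv).1)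

lemma coeff_loopGF (a b : R) (n : ℕ) :
    coeff n (loopGF ({((0:ℤ), (1:ℤ)), (-1, 0), (1, -1)} : Set (ℤ × ℤ)) a b) =
      walkWeight a b n 0 0 := by
  rw [loopGF, coeff_mk, walkWeight]
  change _ = (transfer a b ^ n) (pointMass R 0 0) (0, 0).1 (0, 0).2
  rw [← sum_walksFrom]
  have hloop : ∀ w : Fin (n + 1) → ℕ × ℕ,
      IsQPLoop ({((0:ℤ), (1:ℤ)), (-1, 0), (1, -1)} : Set (ℤ × ℤ)) n w ↔
        w ∈ (walksFrom n (0, 0)).filter fun w => w (Fin.last n) = (0, 0) := by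
    intro w
    simp only [IsQPLoop, Finset.mem_filter, mem_walksFrom, mem_neighbors]
    tauto
  rw [finsum_subtype_eq_finsum_cond (IsQPLoop _ n) (f := fun w => a ^ hvisits w * b ^ vvisits w)]
  simp only [hloop]
  rw [finsum_mem_finset_eq_sum, Finset.sum_filter]
  refine Finset.sum_congr rfl fun w _ => ?_
  simp [pointMass, Prod.ext_iff]

end Loops

section Symmetry

variable {R A : Type*} [CommRing R] [CommRing A] [Algebra R A]

/-- The sequence `0, 1, s (1 - t² s), …` defined by
`u (n + 2) = s (1 - t² s) u (n + 1) - t s u n`. -/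
def kernelSeq (s t : A) : ℕ → A
  | 0 => 0
  | 1 => 1
  | n + 2 => s * (1 - t ^ 2 * s) * kernelSeq s t (n + 1) - t * s * kernelSeq s t n

/-- The boundary factor of the harmonic-type function `kernelFun`. -/
def kernelFactor (b : R) (s t : A) (i : ℕ) : A :=
  b • kernelSeq s t (i + 1) - (b - 1) • (s * kernelSeq s t i)

/-- A function on the quadrant which `transfer` reproduces up to `axisTerm`. -/
def kernelFun (a b : R) (s t : A) : ℕ → ℕ → A
  | 0, 0 => 1
  | 0, j + 1 => a • (t * s) ^ (j + 1)
  | i + 1, 0 => kernelFactor b s t (i + 1)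
  | i + 1, j + 1 => a • ((t * s) ^ (j + 1) * kernelFactor b s t (i + 1))

/-- The defect of `kernelFun` under `transfer`, supported on the horizontal axis. It is symmetric
in `a` and `b`. -/
def axisTerm (a b : R) (s t : A) (i : ℕ) : A :=
  (a * b) • ((1 - t ^ 2 * s) * kernelSeq s t (i + 1) - t * kernelSeq s t i) -
    (a * b + a * b - (a + b)) • kernelSeq s t (i + 1) +
    ((a - 1) * (b - 1)) • (s * kernelSeq s t i + if i = 0 then 1 else 0)

/-- Extension by zero from the horizontal axis to the quadrant. -/
def onAxis {M : Type*} [Zero M] (g : ℕ → M) : ℕ → ℕ → M := fun i j => if j = 0 then g i else 0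

lemma axisTerm_comm (a b : R) (s t : A) (i : ℕ) : axisTerm a b s t i = axisTerm b a s t i := by
  rw [axisTerm, axisTerm, mul_comm a b, add_comm a b, mul_comm (a - 1)]

lemma siteWeight_smul_kernelFun (a b : R) (s t : A) (i j : ℕ) :
    siteWeight a b i j • kernelFun a b s t i j = a • ((t * s) ^ j * kernelFactor b s t i) := by
  rcases i with _ | i <;> rcases j with _ | j <;>
    simp [siteWeight, kernelFun, kernelFactor, kernelSeq, Algebra.smul_def]
  ring

lemma kernelFun_eq (a b : R) (s t : A) :
    kernelFun a b s t = onAxis (axisTerm a b s t) + t • transfer a b (kernelFun a b s t) := by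
  have h : transfer a b (kernelFun a b s t) =
      neighborSum fun i j => a • ((t * s) ^ j * kernelFactor b s t i) := by
    simp only [← siteWeight_smul_kernelFun]; rfl
  rw [h]
  funext i j
  rcases i with _ | i <;> rcases j with _ | j <;>
    simp [onAxis, neighborSum, kernelFun, axisTerm, kernelFactor, kernelSeq,
      Algebra.smul_def] <;> ring

lemma one_eq_sum_walkSum (a b : R) (s t : A) (N : ℕ) :
    (1 : A) = ∑ n ∈ Finset.range N, t ^ n * walkSum a b n (onAxis (axisTerm a b s t)) +
      t ^ N * walkSum a b N (kernelFun a b s t) := by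
  induction N with
  | zero => simp [walkSum_zero, kernelFun]
  | succ N ih =>
    have h : walkSum a b N (kernelFun a b s t) =
        walkSum a b N (onAxis (axisTerm a b s t)) + t * walkSum a b (N + 1) (kernelFun a b s t) := by
      conv_lhs => rw [kernelFun_eq, map_add]
      congr 1
      rw [walkSum_succ]
      exact map_walkSum (LinearMap.mulLeft R t) a b N _
    rw [Finset.sum_range_succ, add_assoc, pow_succ, mul_assoc, ← mul_add, ← h]
    exact ih

lemma map_kernelSeq {B : Type*} [CommRing B] (φ : A →+* B) (s t : A) (n : ℕ) :
    φ (kernelSeq s t n) = kernelSeq (φ s) (φ t) n := by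
  induction n using kernelSeq.induct with
  | case1 => simp [kernelSeq]
  | case2 => simp [kernelSeq]
  | case3 n ih ih' => simp [kernelSeq, ih, ih']

lemma map_axisTerm {B : Type*} [CommRing B] [Algebra R B] (φ : A →ₐ[R] B) (a b : R) (s t : A)
    (n : ℕ) : φ (axisTerm a b s t n) = axisTerm a b (φ s) (φ t) n := by
  have h := map_kernelSeq (φ : A →+* B) s t
  simp only [AlgHom.coe_toRingHom] at h
  simp [axisTerm, h, apply_ite φ]

lemma kernelSeq_zero_right (s : A) (n : ℕ) : kernelSeq s 0 (n + 1) = s ^ n := by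
  induction n with
  | zero => simp [kernelSeq]
  | succ n ih => simp [kernelSeq, ih, pow_succ']

lemma axisTerm_zero_right (a b : R) (s : A) (n : ℕ) : axisTerm a b s 0 n = s ^ n := by
  rcases n with _ | n
  · simp [axisTerm, kernelSeq, Algebra.smul_def]; ring
  · simp [axisTerm, kernelSeq_zero_right, Algebra.smul_def]; ring

end Symmetry

section Symmetry

universe u
variable {R : Type u} [CommRing R]

open scoped Polynomial in
lemma walkSum_onAxis_comm (a b : R) (n : ℕ) {M : Type u} [AddCommGroup M] [Module R M]
    (g : ℕ → M) : walkSum a b n (onAxis g) = walkSum b a n (onAxis g) := by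
  induction n using Nat.strong_induction_on generalizing M with
  | _ n ih =>
  let L : ℕ → R[X][X] := axisTerm a b (Polynomial.C Polynomial.X) Polynomial.X
  have hL : axisTerm b a (Polynomial.C Polynomial.X) (Polynomial.X : R[X][X]) = L :=
    funext fun i => axisTerm_comm b a _ _ i
  have h1 := one_eq_sum_walkSum a b (Polynomial.C Polynomial.X : R[X][X]) Polynomial.X (n + 1)
  have h2 := one_eq_sum_walkSum b a (Polynomial.C Polynomial.X : R[X][X]) Polynomial.X (n + 1)
  rw [hL] at h2
  rw [h1, Finset.sum_range_succ, Finset.sum_range_succ,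
    Finset.sum_congr rfl fun m hm => by rw [ih m (Finset.mem_range.1 hm)], add_assoc, add_assoc,
    add_right_inj] at h2
  have h3 := congrArg (fun p => Polynomial.coeff p n) h2
  simp only [Polynomial.coeff_add, Polynomial.coeff_X_pow_mul', le_refl, if_true,
    Nat.not_succ_le_self, if_false, add_zero, Nat.sub_self] at h3
  let ε : R[X][X] →ₐ[R] R[X] := (Polynomial.aeval (0 : R[X])).restrictScalars R
  have hε : ∀ p : R[X][X], p.coeff 0 = ε p := fun p => by
    simp [ε, Polynomial.coeff_zero_eq_aeval_zero]
  have hεL : (fun i j => ε (onAxis L i j)) = onAxis fun i => (Polynomial.X : R[X]) ^ i := by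
    funext i j
    simp only [onAxis, L, apply_ite ε, map_axisTerm, map_zero]
    simp [ε, axisTerm_zero_right]
  rw [hε, hε] at h3
  have h4 : walkSum a b n (onAxis fun i => (Polynomial.X : R[X]) ^ i) =
      walkSum b a n (onAxis fun i => (Polynomial.X : R[X]) ^ i) := by
    rw [← hεL]
    exact (map_walkSum ε.toLinearMap a b n _).trans
      (h3.trans (map_walkSum ε.toLinearMap b a n _).symm)
  let ψ : R[X] →ₗ[R] M := (Polynomial.basisMonomials R).constr R g
  have hψ : (fun i j => ψ (onAxis (fun i => (Polynomial.X : R[X]) ^ i) i j)) = onAxis g := by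
    funext i j
    simp only [onAxis, apply_ite ψ, map_zero]
    congr 1
    rw [← (Polynomial.basisMonomials R).constr_basis R g i, Polynomial.coe_basisMonomials,
      Polynomial.X_pow_eq_monomial]
  rw [← hψ, map_walkSum, map_walkSum, h4]

lemma walkWeight_axis_comm (a b : R) (n i : ℕ) : walkWeight a b n i 0 = walkWeight b a n i 0 := by
  have h : pointMass R i 0 = onAxis fun k => if k = i then 1 else 0 := by
    funext x y
    by_cases hx : x = i <;> by_cases hy : y = 0 <;> simp [pointMass, onAxis, hx, hy]
  rw [walkWeight, walkWeight, h, walkSum_onAxis_comm]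

end Symmetry

section BoundaryWeight

variable {R : Type*} [CommRing R]

/-- The generating function of the weighted walks from `(0, 0)` to `(i, j)`. -/
noncomputable def walkSeries (a b : R) (i j : ℕ) : R⟦X⟧ := PowerSeries.mk fun n => walkWeight a b n i j

lemma walkSeries_zero_zero (a b : R) :
    walkSeries a b 0 0 = 1 + X * (C (a * b) * walkSeries a b 1 0) := by
  ext n
  rcases n with _ | n
  · simp [walkSeries, walkWeight_zero]
  · simp only [walkSeries, coeff_mk, map_add, coeff_succ_X_mul, coeff_C_mul,
      walkWeight_succ_zero_zero, coeff_one, if_neg (Nat.succ_ne_zero n), zero_add]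

lemma walkSeries_succ_zero (a b : R) (i : ℕ) :
    walkSeries a b (i + 1) 0 = X * (C a * (walkSeries a b (i + 2) 0 + walkSeries a b i 1)) := by
  ext n
  rcases n with _ | n
  · simp [walkSeries, walkWeight_zero]
  · simp only [walkSeries, coeff_mk, map_add, coeff_succ_X_mul, coeff_C_mul,
      walkWeight_succ_succ_zero]

lemma walkSeries_zero_succ (a b : R) (j : ℕ) :
    walkSeries a b 0 (j + 1) = X * (C b * (walkSeries a b 0 j + walkSeries a b 1 (j + 1))) := by
  ext n
  rcases n with _ | n
  · simp [walkSeries, walkWeight_zero]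
  · simp only [walkSeries, coeff_mk, map_add, coeff_succ_X_mul, coeff_C_mul,
      walkWeight_succ_zero_succ]

lemma walkSeries_succ_succ (a b : R) (i j : ℕ) :
    walkSeries a b (i + 1) (j + 1) =
      X * (walkSeries a b (i + 1) j + walkSeries a b (i + 2) (j + 1) +
        walkSeries a b i (j + 2)) := by
  ext n
  rcases n with _ | n
  · simp [walkSeries, walkWeight_zero]
  · simp only [walkSeries, coeff_mk, map_add, coeff_succ_X_mul, walkWeight_succ_succ_succ]

/-- Splitting off the last visit to the horizontal axis removes the weight `a`. -/
lemma walkSeries_remove_left (a b : R) (i j : ℕ) :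
    (C a - 1) * walkSeries a b i (j + 1) = X * (C a * walkSeries a b i j -
      (1 - (C a - 1) * (C b - 1) * walkSeries a b 0 0) * walkSeries 1 b i j) := by
  set K := 1 - (C a - 1) * (C b - 1) * walkSeries a b 0 0 with hK
  let δ : ℕ → ℕ → R⟦X⟧ := fun i j =>
    (C a - 1) * walkSeries a b i (j + 1) - X * (C a * walkSeries a b i j - K * walkSeries 1 b i j)
  have h00 : δ 0 0 = X * (C b * δ 1 0) := by
    have e1 := walkSeries_zero_zero a b
    have e2 := walkSeries_zero_zero 1 b
    have e3 := walkSeries_zero_succ a b 0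
    rw [map_mul] at e1 e2
    rw [map_one] at e2
    simp only [δ, zero_add] at *
    linear_combination (C a - 1) * e3 - X * e1 + X * K * e2 + X * hK
  have hs0 : ∀ i, δ (i + 1) 0 = X * (δ (i + 2) 0 + δ i 1) := fun i => by
    have e1 := walkSeries_succ_succ a b i 0
    have e2 := walkSeries_succ_zero a b i
    have e3 := walkSeries_succ_zero 1 b i
    rw [map_one] at e3
    simp only [δ, zero_add] at *
    linear_combination (C a - 1) * e1 - X * e2 + X * K * e3
  have h0s : ∀ j, δ 0 (j + 1) = X * (C b * (δ 0 j + δ 1 (j + 1))) := fun j => by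
    have e1 := walkSeries_zero_succ a b (j + 1)
    have e2 := walkSeries_zero_succ a b j
    have e3 := walkSeries_zero_succ 1 b j
    simp only [δ]
    linear_combination (C a - 1) * e1 - X * C a * e2 + X * K * e3
  have hss : ∀ i j, δ (i + 1) (j + 1) = X * (δ (i + 1) j + δ (i + 2) (j + 1) + δ i (j + 2)) :=
    fun i j => by
    have e1 := walkSeries_succ_succ a b i (j + 1)
    have e2 := walkSeries_succ_succ a b i j
    have e3 := walkSeries_succ_succ 1 b i j
    simp only [δ]
    linear_combination (C a - 1) * e1 - X * C a * e2 + X * K * e3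
  have key : ∀ n i j, coeff n (δ i j) = 0 := by
    intro n
    induction n with
    | zero =>
      rintro (_ | i) (_ | j)
      · rw [h00, coeff_zero_X_mul]
      · rw [h0s, coeff_zero_X_mul]
      · rw [hs0, coeff_zero_X_mul]
      · rw [hss, coeff_zero_X_mul]
    | succ n ih =>
      rintro (_ | i) (_ | j)
      · rw [h00, coeff_succ_X_mul, coeff_C_mul, ih, mul_zero]
      · rw [h0s, coeff_succ_X_mul, coeff_C_mul, map_add, ih, ih, add_zero, mul_zero]
      · rw [hs0, coeff_succ_X_mul, map_add, ih, ih, add_zero]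
      · rw [hss, coeff_succ_X_mul, map_add, map_add, ih, ih, ih, add_zero, add_zero]
  exact sub_eq_zero.1 (PowerSeries.ext fun n => (key n i j).trans (map_zero _).symm)

/-- The relation expressing the interacting generating function through its specialisations
at `b = 1` and `a = 1`. -/
lemma walkSeries_relation (a b : R) :
    walkSeries a b 0 0 *
      ((C b - C a) * C a ^ 2 * C b ^ 2 * X ^ 3 + (C a - 1) * (C b - 1) * (C a ^ 2 * C b ^ 2 * X ^ 3 *
        ((C b - 1) * walkSeries b 1 0 0 - (C a - 1) * walkSeries a 1 0 0) - (C b - C a))) =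
      C a ^ 2 * C b ^ 2 * X ^ 3 *
        ((C b - 1) * walkSeries b 1 0 0 - (C a - 1) * walkSeries a 1 0 0) -
        (C a - 1) * (C b - 1) * (C b - C a) := by
  have axis : ∀ (a b : R) i, walkSeries a b i 0 = walkSeries b a i 0 := fun a b i => by
    ext n
    simp only [walkSeries, coeff_mk, walkWeight_axis_comm a b]
  have e1 := walkSeries_zero_zero a b
  have e2 := walkSeries_succ_zero a b 0
  have e3 := walkSeries_succ_zero b a 0
  have e4 := walkSeries_remove_left a b 0 0
  have e5 := walkSeries_remove_left b a 0 0
  rw [axis 1 b] at e4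
  rw [axis 1 a, axis b a] at e5
  rw [axis b a, axis b a] at e3
  rw [map_mul] at e1
  simp only [zero_add] at *
  linear_combination -(C a - 1) * (C b - 1) * ((C b - C a) * e1 +
    C a * C b * X * (C b * e2 - C a * e3)) -
    X ^ 2 * C a ^ 2 * C b ^ 2 * ((C b - 1) * e4 - (C a - 1) * e5)

end BoundaryWeight

section Unweighted

/-- The number of walks of Model 17 of length `3 k + 2 i + j` from `(0, 0)` to `(i, j)`, as given
by the hook length formula. -/
def hookValue (k i j : ℕ) : ℚ :=
  (3 * k + 2 * i + j).factorial * ((j + 1) * (i + 1) * (i + j + 2)) /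
    ((k + i + j + 2).factorial * (k + i + 1).factorial * k.factorial)

lemma hookValue_succ_zero_zero (k : ℕ) : hookValue (k + 1) 0 0 = hookValue k 1 0 := by
  simp only [hookValue, show 3 * (k + 1) + 2 * 0 + 0 = 3 * k + 2 + 1 by ring,
    show 3 * k + 2 * 1 + 0 = 3 * k + 2 by ring, show k + 1 + 0 + 0 + 2 = k + 3 by ring,
    show k + 1 + 0 + 1 = k + 2 by ring,
    Nat.factorial_succ]
  push_cast
  field_simp
  ring

lemma hookValue_zero_succ_zero (i : ℕ) : hookValue 0 (i + 1) 0 = hookValue 0 i 1 := by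
  simp only [hookValue, show 3 * 0 + 2 * (i + 1) + 0 = 2 * i + 1 + 1 by ring,
    show 3 * 0 + 2 * i + 1 = 2 * i + 1 by ring, show 0 + (i + 1) + 0 + 2 = i + 3 by ring,
    show 0 + (i + 1) + 1 = i + 2 by ring,
    show 0 + i + 1 = i + 1 by ring, Nat.factorial_succ]
  push_cast
  field_simp
  ring

lemma hookValue_succ_succ_zero (k i : ℕ) :
    hookValue (k + 1) (i + 1) 0 = hookValue k (i + 2) 0 + hookValue (k + 1) i 1 := by
  simp only [hookValue, show 3 * (k + 1) + 2 * (i + 1) + 0 = 3 * k + 2 * i + 4 + 1 by ring,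
    show 3 * (k + 1) + 2 * i + 1 = 3 * k + 2 * i + 4 by ring,
    show 3 * k + 2 * (i + 2) + 0 = 3 * k + 2 * i + 4 by ring,
    show k + 1 + (i + 1) + 0 + 2 = k + i + 4 by ring,
    show k + 1 + (i + 1) + 1 = k + i + 3 by ring, show k + (i + 2) + 0 + 2 = k + i + 4 by ring,
    show k + (i + 2) + 1 = k + i + 3 by ring,
    show k + 1 + i + 1 = k + i + 2 by ring, Nat.factorial_succ]
  push_cast
  field_simp
  ring

lemma hookValue_zero_zero_succ (j : ℕ) : hookValue 0 0 (j + 1) = hookValue 0 0 j := by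
  simp only [hookValue, show 3 * 0 + 2 * 0 + (j + 1) = j + 1 by ring,
    show 3 * 0 + 2 * 0 + j = j by ring,
    Nat.factorial_succ]
  push_cast
  field_simp
  ring

lemma hookValue_succ_zero_succ (k j : ℕ) :
    hookValue (k + 1) 0 (j + 1) = hookValue (k + 1) 0 j + hookValue k 1 (j + 1) := by
  simp only [hookValue, show 3 * (k + 1) + 2 * 0 + (j + 1) = 3 * k + j + 3 + 1 by ring,
    show 3 * (k + 1) + 2 * 0 + j = 3 * k + j + 3 by ring,
    show 3 * k + 2 * 1 + (j + 1) = 3 * k + j + 3 by ring,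
    show k + 1 + 0 + (j + 1) + 2 = k + j + 4 by ring,
    show k + 1 + 0 + j + 2 = k + j + 3 by ring,
    show k + 1 + 0 + 1 = k + 2 by ring, Nat.factorial_succ]
  push_cast
  field_simp
  ring

lemma hookValue_zero_succ_succ (i j : ℕ) :
    hookValue 0 (i + 1) (j + 1) = hookValue 0 (i + 1) j + hookValue 0 i (j + 2) := by
  simp only [hookValue, show 3 * 0 + 2 * (i + 1) + (j + 1) = 2 * i + j + 2 + 1 by ring,
    show 3 * 0 + 2 * (i + 1) + j = 2 * i + j + 2 by ring,
    show 3 * 0 + 2 * i + (j + 2) = 2 * i + j + 2 by ring,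
    show 0 + (i + 1) + (j + 1) + 2 = i + j + 4 by ring,
    show 0 + (i + 1) + j + 2 = i + j + 3 by ring, show 0 + i + (j + 2) + 2 = i + j + 4 by ring,
    show 0 + (i + 1) + 1 = i + 2 by ring, show 0 + i + 1 = i + 1 by ring, Nat.factorial_succ]
  push_cast
  field_simp
  ring

lemma hookValue_succ_succ_succ (k i j : ℕ) :
    hookValue (k + 1) (i + 1) (j + 1) =
      hookValue (k + 1) (i + 1) j + hookValue k (i + 2) (j + 1) + hookValue (k + 1) i (j + 2) := by
  simp only [hookValue,
    show 3 * (k + 1) + 2 * (i + 1) + (j + 1) = 3 * k + 2 * i + j + 5 + 1 by ring,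
    show 3 * (k + 1) + 2 * (i + 1) + j = 3 * k + 2 * i + j + 5 by ring,
    show 3 * k + 2 * (i + 2) + (j + 1) = 3 * k + 2 * i + j + 5 by ring,
    show 3 * (k + 1) + 2 * i + (j + 2) = 3 * k + 2 * i + j + 5 by ring,
    show k + 1 + (i + 1) + (j + 1) + 2 = k + i + j + 5 by ring,
    show k + 1 + (i + 1) + j + 2 = k + i + j + 4 by ring,
    show k + (i + 2) + (j + 1) + 2 = k + i + j + 5 by ring,
    show k + 1 + i + (j + 2) + 2 = k + i + j + 5 by ring,
    show k + 1 + (i + 1) + 1 = k + i + 3 by ring, show k + (i + 2) + 1 = k + i + 3 by ring,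
    show k + 1 + i + 1 = k + i + 2 by ring, Nat.factorial_succ]
  push_cast
  field_simp
  ring

lemma walkWeight_one_one (k i j : ℕ) :
    walkWeight (1 : ℚ) 1 (3 * k + 2 * i + j) i j = hookValue k i j := by
  obtain ⟨n, hn⟩ : ∃ n, n = 3 * k + 2 * i + j := ⟨_, rfl⟩
  rw [← hn]
  induction n generalizing k i j with
  | zero =>
    obtain ⟨rfl, rfl, rfl⟩ : k = 0 ∧ i = 0 ∧ j = 0 := by omega
    simp [walkWeight_zero, hookValue]
  | succ n ih =>
    rcases i with _ | i <;> rcases j with _ | j <;> rcases k with _ | k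
    · omega
    · rw [walkWeight_succ_zero_zero, ih k 1 0 (by omega), hookValue_succ_zero_zero, one_mul, one_mul]
    · rw [walkWeight_succ_zero_succ, ih 0 0 j (by omega), walkWeight_eq_zero_of_lt _ _ (by omega),
        hookValue_zero_zero_succ, one_mul, add_zero]
    · rw [walkWeight_succ_zero_succ, ih (k + 1) 0 j (by omega), ih k 1 (j + 1) (by omega),
        hookValue_succ_zero_succ, one_mul]
    · rw [walkWeight_succ_succ_zero, ih 0 i 1 (by omega), walkWeight_eq_zero_of_lt _ _ (by omega),
        hookValue_zero_succ_zero, one_mul, zero_add]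
    · rw [walkWeight_succ_succ_zero, ih k (i + 2) 0 (by omega), ih (k + 1) i 1 (by omega),
        hookValue_succ_succ_zero, one_mul]
    · rw [walkWeight_succ_succ_succ, ih 0 (i + 1) j (by omega), ih 0 i (j + 2) (by omega),
        walkWeight_eq_zero_of_lt _ _ (by omega), hookValue_zero_succ_succ, add_zero]
    · rw [walkWeight_succ_succ_succ, ih (k + 1) (i + 1) j (by omega),
        ih k (i + 2) (j + 1) (by omega), ih (k + 1) i (j + 2) (by omega),
        hookValue_succ_succ_succ]

lemma walkWeight_one_one_zero (n : ℕ) : walkWeight (1 : ℚ) 1 n 0 n = 1 := by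
  have h := walkWeight_one_one 0 0 n
  rw [show 3 * 0 + 2 * 0 + n = n by ring] at h
  rw [h, hookValue, show 3 * 0 + 2 * 0 + n = n by ring,
    Nat.factorial_succ, Nat.factorial_succ]
  push_cast
  field_simp
  simp
  ring

/-- The geometric series `1 / (1 - X)`. -/
noncomputable def geomSeries : ℚ⟦X⟧ := PowerSeries.mk 1

lemma geomSeries_mul : geomSeries * (1 - X) = 1 := mk_one_mul_one_sub_eq_one ℚ

lemma eq_geomSeries_mul {f g : ℚ⟦X⟧} (h0 : coeff 0 f = coeff 0 g)
    (h : ∀ l, coeff (l + 1) f = coeff l f + coeff (l + 1) g) : f = geomSeries * g := by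
  have hg : g = f * (1 - X) := by
    ext l
    rcases l with _ | l
    · rw [mul_sub, map_sub, coeff_zero_mul_X, mul_one, h0, sub_zero]
    · rw [mul_sub, map_sub, coeff_succ_mul_X, mul_one, h, add_sub_cancel_left]
  rw [hg, mul_left_comm, geomSeries_mul, mul_one]

/-- The substitution `a = 1 / (1 - X)` turns the weight of walks into their unweighted
generating function along the vertical direction. -/
lemma geomSeries_mul_walkWeight (n i j : ℕ) :
    geomSeries * walkWeight geomSeries 1 n i j =
      PowerSeries.mk fun l => walkWeight (1 : ℚ) 1 (n + l) i (j + l) := by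
  induction n generalizing i j with
  | zero =>
    ext l
    rw [walkWeight_zero, coeff_mk, zero_add]
    split_ifs with h
    · rw [h.1, h.2, zero_add, walkWeight_one_one_zero, geomSeries, mul_one, coeff_mk, Pi.one_apply]
    · rw [walkWeight_eq_zero_of_lt _ _ (by omega), mul_zero, map_zero]
  | succ n ih =>
    rcases i with _ | i <;> rcases j with _ | j
    · rw [walkWeight_succ_zero_zero, mul_one, ih]
      symm
      apply eq_geomSeries_mul
      · simp only [coeff_mk, add_zero, walkWeight_succ_zero_zero, one_mul]
      · intro l
        simp only [coeff_mk, zero_add, show n + 1 + (l + 1) = n + (l + 1) + 1 by ring,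
          show n + 1 + l = n + (l + 1) by ring, walkWeight_succ_zero_succ, one_mul]
    · rw [walkWeight_succ_zero_succ, one_mul, mul_add, ih, ih]
      ext l
      simp only [coeff_mk, map_add, show n + 1 + l = n + l + 1 by ring,
        show j + 1 + l = j + l + 1 by ring, walkWeight_succ_zero_succ, one_mul]
    · rw [walkWeight_succ_succ_zero, mul_add, mul_add, ih, ih]
      rw [← mul_add]
      symm
      apply eq_geomSeries_mul
      · simp only [coeff_mk, map_add, add_zero, walkWeight_succ_succ_zero, one_mul]
      · intro l
        simp only [coeff_mk, map_add, zero_add, show n + 1 + (l + 1) = n + (l + 1) + 1 by ring,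
          show n + 1 + l = n + (l + 1) by ring, walkWeight_succ_succ_succ,
          show 1 + (l + 1) = l + 2 by ring]
        ring
    · rw [walkWeight_succ_succ_succ, mul_add, mul_add, ih, ih, ih]
      ext l
      simp only [coeff_mk, map_add, show n + 1 + l = n + l + 1 by ring,
        show j + 1 + l = j + l + 1 by ring, show j + 2 + l = j + l + 2 by ring,
        walkWeight_succ_succ_succ]

end Unweighted

section Recurrence

/-- The coefficient of the weight of length `3 (m + 2)` in the recurrence satisfied by the weights
of the loops of length `3 m` with boundary weights `a` and `1`. -/
def recCoeff₂ {K : Type*} [CommRing K] (a m : K) : K :=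
  (m + 2) ^ 2 * (m + 3) * (3 * (3 * m - 1) - 6 * (2 * m - 1) * a + (m - 5) * a ^ 2 +
    2 * (m + 1) * a ^ 3)

/-- The coefficient of the weight of length `3 (m + 1)` in the same recurrence. -/
def recCoeff₁ {K : Type*} [CommRing K] (a m : K) : K :=
  (m + 2) * (-9 * (3 * m + 2) * (3 * m + 1) * (3 * m - 1) +
    18 * (2 * m - 1) * (3 * m + 2) * (3 * m + 1) * a +
    (3 * m + 1) * (-6 + 39 * m - 9 * m ^ 2) * a ^ 2 - 6 * m * (3 * m - 7) * (m + 2) * a ^ 3 -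
    6 * (m - 1) * (2 * m + 3) * (m + 2) * a ^ 4 - 4 * (2 * m + 3) * (m + 1) * (m + 2) * a ^ 5)

/-- The coefficient of the weight of length `3 m` in the same recurrence. -/
def recCoeff₀ {K : Type*} [CommRing K] (a m : K) : K :=
  a ^ 3 * (2 * m - 1) * (3 * m + 2) * (3 * m + 1) *
    (-18 * (3 * m + 2) + 18 * m * a + 12 * (m + 2) * a ^ 2)

/-- The coefficients of the expansions of `(1 - X) ^ 5 * recCoeff (1 / (1 - X)) m`. -/
def shiftCoeff (m : ℚ) : ℕ → ℕ → ℚ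
  | 0, 0 => -432 * m ^ 4 - 432 * m ^ 3 + 12 * m ^ 2 + 108 * m + 24
  | 0, 1 => 1620 * m ^ 4 + 2106 * m ^ 3 + 198 * m ^ 2 - 540 * m - 144
  | 0, 2 => -972 * m ^ 4 - 1134 * m ^ 3 - 54 * m ^ 2 + 288 * m + 72
  | 1, 0 => 16 * m ^ 4 + 80 * m ^ 3 + 92 * m ^ 2 - 20 * m - 24
  | 1, 1 => 48 * m ^ 4 - 48 * m ^ 3 - 300 * m ^ 2 + 12 * m + 72
  | 1, 2 => -585 * m ^ 4 - 1488 * m ^ 3 - 759 * m ^ 2 - 300 * m - 108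
  | 1, 3 => 1161 * m ^ 4 + 3186 * m ^ 3 + 1797 * m ^ 2 + 108 * m - 60
  | 1, 4 => -891 * m ^ 4 - 2430 * m ^ 3 - 1251 * m ^ 2 + 144 * m + 108
  | 1, 5 => 243 * m ^ 4 + 648 * m ^ 3 + 297 * m ^ 2 - 72 * m - 36
  | 2, 1 => -4 * m ^ 4 - 26 * m ^ 3 - 50 * m ^ 2 - 16 * m + 24
  | 2, 2 => 23 * m ^ 4 + 154 * m ^ 3 + 319 * m ^ 2 + 164 * m - 84
  | 2, 3 => -43 * m ^ 4 - 290 * m ^ 3 - 611 * m ^ 2 - 340 * m + 132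
  | 2, 4 => 33 * m ^ 4 + 222 * m ^ 3 + 465 * m ^ 2 + 252 * m - 108
  | 2, 5 => -9 * m ^ 4 - 60 * m ^ 3 - 123 * m ^ 2 - 60 * m + 36
  | _, _ => 0

/-- `hookValue` as a multiple of a prescribed quotient of factorials. -/
lemma hookValue_eq {k l n p u q v c : ℕ} (hn : 3 * k + l = n + p) (hu : k + l + 2 + q = u)
    (hv : k + c = v) : hookValue k 0 l =
    n.factorial / (u.factorial * (v + 1).factorial * v.factorial) *
      ((n + 1).ascFactorial p * (k + l + 3).ascFactorial q * (k + 2).ascFactorial c *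
        (k + 1).ascFactorial c * ((l + 1) * (l + 2))) := by
  subst hu hv
  have h1 := Nat.factorial_mul_ascFactorial n p
  have h2 := Nat.factorial_mul_ascFactorial (k + l + 2) q
  have h3 := Nat.factorial_mul_ascFactorial (k + 1) c
  have h4 := Nat.factorial_mul_ascFactorial k c
  rw [show k + 1 + c = k + c + 1 by ring] at h3
  rw [← h2, ← h3, ← h4, hookValue, show 3 * k + 2 * 0 + l = n + p by omega, ← h1, add_zero]
  have h5 := (Nat.ascFactorial_pos (k + l + 3) q).ne'
  have h6 := (Nat.ascFactorial_pos (k + 2) c).ne'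
  have h7 := (Nat.ascFactorial_pos (k + 1) c).ne'
  push_cast
  rw [show k + l + 2 + 1 = k + l + 3 by ring, show k + 1 + 1 = k + 2 by ring]
  field_simp
  ring

lemma sum_shiftCoeff (m l : ℕ) :
    ∑ r ∈ Finset.range 3, ∑ s ∈ Finset.range 6,
      (if s ≤ l then shiftCoeff m r s * hookValue (m + r) 0 (l - s) else 0) = 0 := by
  simp only [Finset.sum_range_succ, Finset.sum_range_zero, shiftCoeff]
  have h {i j p : ℕ} (n u q c : ℕ) (hn : 3 * i + j = n + p) (hu : i + j + 2 + q = u)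
    (hv : i + c = m + 2) := hookValue_eq hn hu hv
  obtain hl | ⟨k, rfl⟩ : l < 5 ∨ ∃ k, l = k + 5 :=
    (lt_or_ge l 5).imp_right fun h => ⟨l - 5, by omega⟩
  · interval_cases l
    · have h {i j p : ℕ} := h (i := i) (j := j) (p := p) (3 * m) (m + 3)
      norm_num
      rw [h (i := m) (j := 0) (p := 0) 1 2 (by ring) (by ring) (by ring),
        h (i := (m + 1)) (j := 0) (p := 3) 0 1 (by ring) (by ring) (by ring)]
      generalize ((_ : ℕ) : ℚ) / _ = B
      simp only [Nat.ascFactorial_succ, Nat.ascFactorial_zero]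
      push_cast
      ring
    · have h {i j p : ℕ} := h (i := i) (j := j) (p := p) (3 * m) (m + 4)
      norm_num
      rw [h (i := m) (j := 1) (p := 1) 1 2 (by ring) (by ring) (by ring),
        h (i := m) (j := 0) (p := 0) 2 2 (by ring) (by ring) (by ring),
        h (i := (m + 1)) (j := 1) (p := 4) 0 1 (by ring) (by ring) (by ring),
        h (i := (m + 1)) (j := 0) (p := 3) 1 1 (by ring) (by ring) (by ring),
        h (i := (m + 2)) (j := 0) (p := 6) 0 0 (by ring) (by ring) (by ring)]
      generalize ((_ : ℕ) : ℚ) / _ = B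
      simp only [Nat.ascFactorial_succ, Nat.ascFactorial_zero]
      push_cast
      ring
    · have h {i j p : ℕ} := h (i := i) (j := j) (p := p) (3 * m) (m + 5)
      norm_num
      rw [h (i := m) (j := 2) (p := 2) 1 2 (by ring) (by ring) (by ring),
        h (i := m) (j := 1) (p := 1) 2 2 (by ring) (by ring) (by ring),
        h (i := m) (j := 0) (p := 0) 3 2 (by ring) (by ring) (by ring),
        h (i := (m + 1)) (j := 2) (p := 5) 0 1 (by ring) (by ring) (by ring),
        h (i := (m + 1)) (j := 1) (p := 4) 1 1 (by ring) (by ring) (by ring),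
        h (i := (m + 1)) (j := 0) (p := 3) 2 1 (by ring) (by ring) (by ring),
        h (i := (m + 2)) (j := 1) (p := 7) 0 0 (by ring) (by ring) (by ring),
        h (i := (m + 2)) (j := 0) (p := 6) 1 0 (by ring) (by ring) (by ring)]
      generalize ((_ : ℕ) : ℚ) / _ = B
      simp only [Nat.ascFactorial_succ, Nat.ascFactorial_zero]
      push_cast
      ring
    · have h {i j p : ℕ} := h (i := i) (j := j) (p := p) (3 * m + 1) (m + 6)
      norm_num
      rw [h (i := m) (j := 3) (p := 2) 1 2 (by ring) (by ring) (by ring),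
        h (i := m) (j := 2) (p := 1) 2 2 (by ring) (by ring) (by ring),
        h (i := m) (j := 1) (p := 0) 3 2 (by ring) (by ring) (by ring),
        h (i := (m + 1)) (j := 3) (p := 5) 0 1 (by ring) (by ring) (by ring),
        h (i := (m + 1)) (j := 2) (p := 4) 1 1 (by ring) (by ring) (by ring),
        h (i := (m + 1)) (j := 1) (p := 3) 2 1 (by ring) (by ring) (by ring),
        h (i := (m + 1)) (j := 0) (p := 2) 3 1 (by ring) (by ring) (by ring),
        h (i := (m + 2)) (j := 2) (p := 7) 0 0 (by ring) (by ring) (by ring),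
        h (i := (m + 2)) (j := 1) (p := 6) 1 0 (by ring) (by ring) (by ring),
        h (i := (m + 2)) (j := 0) (p := 5) 2 0 (by ring) (by ring) (by ring)]
      generalize ((_ : ℕ) : ℚ) / _ = B
      simp only [Nat.ascFactorial_succ, Nat.ascFactorial_zero]
      push_cast
      ring
    · have h {i j p : ℕ} := h (i := i) (j := j) (p := p) (3 * m + 2) (m + 7)
      norm_num
      rw [h (i := m) (j := 4) (p := 2) 1 2 (by ring) (by ring) (by ring),
        h (i := m) (j := 3) (p := 1) 2 2 (by ring) (by ring) (by ring),
        h (i := m) (j := 2) (p := 0) 3 2 (by ring) (by ring) (by ring),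
        h (i := (m + 1)) (j := 4) (p := 5) 0 1 (by ring) (by ring) (by ring),
        h (i := (m + 1)) (j := 3) (p := 4) 1 1 (by ring) (by ring) (by ring),
        h (i := (m + 1)) (j := 2) (p := 3) 2 1 (by ring) (by ring) (by ring),
        h (i := (m + 1)) (j := 1) (p := 2) 3 1 (by ring) (by ring) (by ring),
        h (i := (m + 1)) (j := 0) (p := 1) 4 1 (by ring) (by ring) (by ring),
        h (i := (m + 2)) (j := 3) (p := 7) 0 0 (by ring) (by ring) (by ring),
        h (i := (m + 2)) (j := 2) (p := 6) 1 0 (by ring) (by ring) (by ring),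
        h (i := (m + 2)) (j := 1) (p := 5) 2 0 (by ring) (by ring) (by ring),
        h (i := (m + 2)) (j := 0) (p := 4) 3 0 (by ring) (by ring) (by ring)]
      generalize ((_ : ℕ) : ℚ) / _ = B
      simp only [Nat.ascFactorial_succ, Nat.ascFactorial_zero]
      push_cast
      ring
  · have h {i j p : ℕ} := h (i := i) (j := j) (p := p) (3 * m + k + 3) (m + k + 8)
    simp only [Nat.reduceSubDiff, if_true, le_add_iff_nonneg_left, zero_le, add_tsub_cancel_right,
      Nat.sub_zero, add_zero, zero_mul, zero_add, ite_self]
    rw [h (i := m) (j := (k + 5)) (p := 2) 1 2 (by ring) (by ring) (by ring),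
      h (i := m) (j := (k + 4)) (p := 1) 2 2 (by ring) (by ring) (by ring),
      h (i := m) (j := (k + 3)) (p := 0) 3 2 (by ring) (by ring) (by ring),
      h (i := (m + 1)) (j := (k + 5)) (p := 5) 0 1 (by ring) (by ring) (by ring),
      h (i := (m + 1)) (j := (k + 4)) (p := 4) 1 1 (by ring) (by ring) (by ring),
      h (i := (m + 1)) (j := (k + 3)) (p := 3) 2 1 (by ring) (by ring) (by ring),
      h (i := (m + 1)) (j := (k + 2)) (p := 2) 3 1 (by ring) (by ring) (by ring),
      h (i := (m + 1)) (j := (k + 1)) (p := 1) 4 1 (by ring) (by ring) (by ring),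
      h (i := (m + 1)) (j := k) (p := 0) 5 1 (by ring) (by ring) (by ring),
      h (i := (m + 2)) (j := (k + 4)) (p := 7) 0 0 (by ring) (by ring) (by ring),
      h (i := (m + 2)) (j := (k + 3)) (p := 6) 1 0 (by ring) (by ring) (by ring),
      h (i := (m + 2)) (j := (k + 2)) (p := 5) 2 0 (by ring) (by ring) (by ring),
      h (i := (m + 2)) (j := (k + 1)) (p := 4) 3 0 (by ring) (by ring) (by ring),
      h (i := (m + 2)) (j := k) (p := 3) 4 0 (by ring) (by ring) (by ring)]
    generalize ((_ : ℕ) : ℚ) / _ = B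
    simp only [Nat.ascFactorial_succ, Nat.ascFactorial_zero]
    push_cast
    ring

lemma map_recCoeff₀ {K L : Type*} [CommRing K] [CommRing L] (φ : K →+* L) (a m : K) :
    φ (recCoeff₀ a m) = recCoeff₀ (φ a) (φ m) := by simp [recCoeff₀, map_ofNat]

lemma map_recCoeff₁ {K L : Type*} [CommRing K] [CommRing L] (φ : K →+* L) (a m : K) :
    φ (recCoeff₁ a m) = recCoeff₁ (φ a) (φ m) := by simp [recCoeff₁, map_ofNat]

lemma map_recCoeff₂ {K L : Type*} [CommRing K] [CommRing L] (φ : K →+* L) (a m : K) :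
    φ (recCoeff₂ a m) = recCoeff₂ (φ a) (φ m) := by simp [recCoeff₂, map_ofNat]

lemma shift_recCoeff (m : ℕ) :
    (1 - X) ^ 5 * recCoeff₀ geomSeries m = ∑ s ∈ Finset.range 6, C (shiftCoeff m 0 s) * X ^ s ∧
    (1 - X) ^ 5 * recCoeff₁ geomSeries m = ∑ s ∈ Finset.range 6, C (shiftCoeff m 1 s) * X ^ s ∧
    (1 - X) ^ 5 * recCoeff₂ geomSeries m = ∑ s ∈ Finset.range 6, C (shiftCoeff m 2 s) * X ^ s := by
  have h1 : (1 - X) * geomSeries = 1 := by rw [mul_comm, geomSeries_mul]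
  have h2 : (1 - X) ^ 2 * geomSeries ^ 2 = 1 := by rw [← mul_pow, h1, one_pow]
  have h3 : (1 - X) ^ 3 * geomSeries ^ 3 = 1 := by rw [← mul_pow, h1, one_pow]
  have h4 : (1 - X) ^ 4 * geomSeries ^ 4 = 1 := by rw [← mul_pow, h1, one_pow]
  have h5 : (1 - X) ^ 5 * geomSeries ^ 5 = 1 := by rw [← mul_pow, h1, one_pow]
  refine ⟨?_, ?_, ?_⟩ <;>
    simp only [Finset.sum_range_succ, Finset.sum_range_zero, shiftCoeff, map_add, map_sub, map_mul,
      map_neg, map_pow, map_natCast, map_ofNat, map_zero]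
  · rw [recCoeff₀]
    linear_combination (2 * (m : ℚ⟦X⟧) - 1) * (3 * m + 2) * (3 * m + 1) *
      (-18 * (3 * m + 2) * (1 - X) ^ 2 * h3 + 18 * m * (1 - X) * h4 + 12 * (m + 2) * h5)
  · rw [recCoeff₁]
    linear_combination ((m : ℚ⟦X⟧) + 2) *
      (18 * (2 * m - 1) * (3 * m + 2) * (3 * m + 1) * (1 - X) ^ 4 * h1 +
      (3 * m + 1) * (-6 + 39 * m - 9 * m ^ 2) * (1 - X) ^ 3 * h2 -
      6 * m * (3 * m - 7) * (m + 2) * (1 - X) ^ 2 * h3 -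
      6 * (m - 1) * (2 * m + 3) * (m + 2) * (1 - X) * h4 -
      4 * (2 * m + 3) * (m + 1) * (m + 2) * h5)
  · rw [recCoeff₂]
    linear_combination ((m : ℚ⟦X⟧) + 2) ^ 2 * (m + 3) * (-6 * (2 * m - 1) * (1 - X) ^ 4 * h1 +
      (m - 5) * (1 - X) ^ 3 * h2 + 2 * (m + 1) * (1 - X) ^ 2 * h3)

lemma walkWeight_recurrence_geomSeries (m : ℕ) :
    recCoeff₀ geomSeries (m : ℚ⟦X⟧) * walkWeight geomSeries 1 (3 * m) 0 0 +
      recCoeff₁ geomSeries (m : ℚ⟦X⟧) * walkWeight geomSeries 1 (3 * (m + 1)) 0 0 +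
      recCoeff₂ geomSeries (m : ℚ⟦X⟧) * walkWeight geomSeries 1 (3 * (m + 2)) 0 0 = 0 := by
  have hU : ∀ k, geomSeries * walkWeight geomSeries 1 (3 * k) 0 0 =
      PowerSeries.mk fun l => hookValue k 0 l := fun k => by
    rw [geomSeries_mul_walkWeight]
    ext l
    simpa using walkWeight_one_one k 0 l
  obtain ⟨h0, h1, h2⟩ := shift_recCoeff m
  have hX : (1 - X : ℚ⟦X⟧) ≠ 0 := right_ne_zero_of_mul_eq_one geomSeries_mul
  refine (mul_eq_zero.1 ?_).resolve_left
    (mul_ne_zero (pow_ne_zero 5 hX) (left_ne_zero_of_mul_eq_one geomSeries_mul))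
  have : ∀ P Q S U V W : ℚ⟦X⟧, (1 - X) ^ 5 * geomSeries * (P * U + Q * V + S * W) =
      (1 - X) ^ 5 * P * (geomSeries * U) + (1 - X) ^ 5 * Q * (geomSeries * V) +
        (1 - X) ^ 5 * S * (geomSeries * W) := fun P Q S U V W => by ring
  rw [this, h0, h1, h2, hU, hU, hU]
  ext l
  have := sum_shiftCoeff m l
  rw [Finset.sum_range_succ, Finset.sum_range_succ, Finset.sum_range_succ, Finset.sum_range_zero,
    zero_add, add_zero] at this
  simp only [Finset.sum_mul, map_add, map_sum, mul_assoc, coeff_C_mul, coeff_X_pow_mul', coeff_mk,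
    mul_ite, mul_zero, map_zero]
  exact this

lemma aeval_geomSeries_injective :
    Function.Injective (Polynomial.aeval geomSeries : Polynomial ℚ →ₐ[ℚ] ℚ⟦X⟧) := by
  rw [injective_iff_map_eq_zero]
  intro p hp
  let : Invertible geomSeries := ⟨1 - X, by rw [mul_comm, geomSeries_mul], geomSeries_mul⟩
  have h1 : Polynomial.aeval (1 - X : ℚ⟦X⟧) p.reverse = 0 := by
    have h := Polynomial.eval₂_reverse_mul_pow (algebraMap ℚ ℚ⟦X⟧) geomSeries p
    rw [← Polynomial.aeval_def, ← Polynomial.aeval_def, hp] at h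
    exact (mul_eq_zero.1 h).resolve_right
      (pow_ne_zero _ (left_ne_zero_of_mul_eq_one geomSeries_mul))
  have h2 : ((p.reverse.comp (1 - Polynomial.X) : Polynomial ℚ) : ℚ⟦X⟧) = 0 := by
    rw [← h1, Polynomial.comp_eq_aeval]
    have := Polynomial.aeval_algHom_apply (Polynomial.coeToPowerSeries.algHom (R := ℚ) ℚ)
      (1 - Polynomial.X) p.reverse
    simpa [Polynomial.coeToPowerSeries.algHom_apply] using this.symm
  have h3 : p.reverse.comp (1 - Polynomial.X) = 0 := by exact_mod_cast h2
  have h4 : (p.reverse.comp (1 - Polynomial.X)).comp (1 - Polynomial.X) = p.reverse := by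
    rw [Polynomial.comp_assoc]; simp
  rw [h3, Polynomial.zero_comp] at h4
  exact Polynomial.reverse_eq_zero.1 h4.symm

/-- The loop weights of Model 17 with boundary weights `a` and `1` satisfy a linear recurrence of
order two with polynomial coefficients. -/
lemma walkWeight_recurrence {R : Type*} [CommRing R] [Algebra ℚ R] (a : R) (m : ℕ) :
    recCoeff₀ a (m : R) * walkWeight a 1 (3 * m) 0 0 +
      recCoeff₁ a (m : R) * walkWeight a 1 (3 * (m + 1)) 0 0 +
      recCoeff₂ a (m : R) * walkWeight a 1 (3 * (m + 2)) 0 0 = 0 := by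
  have key : recCoeff₀ Polynomial.X (m : Polynomial ℚ) * walkWeight Polynomial.X 1 (3 * m) 0 0 +
      recCoeff₁ Polynomial.X (m : Polynomial ℚ) * walkWeight Polynomial.X 1 (3 * (m + 1)) 0 0 +
      recCoeff₂ Polynomial.X (m : Polynomial ℚ) * walkWeight Polynomial.X 1 (3 * (m + 2)) 0 0
        = 0 := by
    apply aeval_geomSeries_injective
    have h := walkWeight_recurrence_geomSeries m
    rw [map_zero, ← h]
    change (Polynomial.aeval geomSeries).toRingHom _ = _
    simp only [map_add, map_mul, map_recCoeff₀, map_recCoeff₁, map_recCoeff₂, map_walkWeight,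
      map_one, map_natCast]
    simp
  have := congrArg (Polynomial.aeval a).toRingHom key
  simp only [map_add, map_mul, map_recCoeff₀, map_recCoeff₁, map_recCoeff₂, map_walkWeight,
    map_one, map_natCast, map_zero] at this
  simpa using this

end Recurrence

section DFinite

variable {R : Type*} [CommRing R]

lemma polynomial_smul_eq (p : Polynomial R) (f : R⟦X⟧) : p • f = (p : R⟦X⟧) * f := by
  rw [Algebra.smul_def]; rfl

lemma derivative_polynomial_smul (p : Polynomial R) (f : R⟦X⟧) :
    derivative R (p • f) = Polynomial.derivative p • f + p • derivative R f := by
  simp only [polynomial_smul_eq, Derivation.leibniz, derivative_coe, smul_eq_mul]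
  ring

/-- A finitely generated module of power series which is stable under differentiation up to a
nonzero polynomial factor. -/
def IsHolonomic (N : Submodule (Polynomial R) R⟦X⟧) : Prop :=
  N.FG ∧ ∃ p : Polynomial R, p ≠ 0 ∧ ∀ v ∈ N, p • derivative R v ∈ N

lemma isHolonomic_span {s : Set R⟦X⟧} (hs : s.Finite) {p : Polynomial R} (hp : p ≠ 0)
    (h : ∀ v ∈ s, p • derivative R v ∈ Submodule.span (Polynomial R) s) :
    IsHolonomic (Submodule.span (Polynomial R) s) := by
  refine ⟨Submodule.fg_span hs, p, hp, fun v hv => ?_⟩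
  induction hv using Submodule.span_induction with
  | mem v hv => exact h v hv
  | zero => simp
  | add v w _ _ hv hw => rw [map_add, smul_add]; exact add_mem hv hw
  | smul q v hv ih =>
    rw [derivative_polynomial_smul, smul_add, smul_comm p q]
    exact add_mem (Submodule.smul_mem _ _ (Submodule.smul_mem _ _ hv)) (Submodule.smul_mem _ _ ih)

lemma isHolonomic_span_one [Nontrivial R] :
    IsHolonomic (Submodule.span (Polynomial R) {(1 : R⟦X⟧)}) :=
  isHolonomic_span (Set.finite_singleton _) one_ne_zero fun v hv => by
    rw [Set.mem_singleton_iff.1 hv, Derivation.map_one_eq_zero, smul_zero]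
    exact zero_mem _

/-- The Euler operator `X d/dX`. -/
noncomputable def eulerOp (R : Type*) [CommRing R] : Module.End R R⟦X⟧ :=
  LinearMap.mulLeft R X ∘ₗ (derivative R).toLinearMap

lemma eulerOp_apply (f : R⟦X⟧) : eulerOp R f = X * derivative R f := rfl

lemma coeff_aeval_eulerOp (p : Polynomial R) (f : R⟦X⟧) (n : ℕ) :
    coeff n (Polynomial.aeval (eulerOp R) p f) = p.eval (n : R) * coeff n f := by
  have hpow : ∀ k, coeff n ((eulerOp R ^ k) f) = (n : R) ^ k * coeff n f := by
    intro k
    induction k with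
    | zero => simp
    | succ k ih =>
      rw [pow_succ', Module.End.mul_apply, pow_succ', mul_assoc, ← ih, eulerOp_apply]
      rcases n with _ | n
      · simp
      · rw [coeff_succ_X_mul, coeff_derivative]; push_cast; ring
  rw [Polynomial.aeval_eq_sum_range, LinearMap.sum_apply, map_sum, Polynomial.eval_eq_sum_range,
    Finset.sum_mul]
  refine Finset.sum_congr rfl fun k _ => ?_
  rw [LinearMap.smul_apply, map_smul, hpow, smul_eq_mul, mul_assoc]

variable [IsDomain R]

lemma IsHolonomic.sup {M N : Submodule (Polynomial R) R⟦X⟧} (hM : IsHolonomic M)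
    (hN : IsHolonomic N) : IsHolonomic (M ⊔ N) := by
  obtain ⟨hM, p, hp, hpM⟩ := hM
  obtain ⟨hN, q, hq, hqN⟩ := hN
  refine ⟨hM.sup hN, p * q, mul_ne_zero hp hq, fun v hv => ?_⟩
  obtain ⟨x, hx, y, hy, rfl⟩ := Submodule.mem_sup.1 hv
  rw [map_add, smul_add]
  refine add_mem (Submodule.mem_sup_left ?_) (Submodule.mem_sup_right ?_)
  · rw [mul_comm, mul_smul]; exact Submodule.smul_mem _ _ (hpM x hx)
  · rw [mul_smul]; exact Submodule.smul_mem _ _ (hqN y hy)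

lemma IsHolonomic.isDFinite {N : Submodule (Polynomial R) R⟦X⟧} (hN : IsHolonomic N) {F : R⟦X⟧}
    (hF : F ∈ N) : IsDFinite F := by
  obtain ⟨hfg, p, hp, hpN⟩ := hN
  have key : ∀ n, ∃ q : Polynomial R, q ≠ 0 ∧ q • (derivative R)^[n] F ∈ N := by
    intro n
    induction n with
    | zero => exact ⟨1, one_ne_zero, by simpa using hF⟩
    | succ n ih =>
      obtain ⟨q, hq, hqN⟩ := ih
      refine ⟨p * q * q, mul_ne_zero (mul_ne_zero hp hq) hq, ?_⟩
      have h := N.smul_mem q (hpN _ hqN)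
      rw [derivative_polynomial_smul] at h
      have h' := N.smul_mem (p * Polynomial.derivative q) hqN
      have e : (p * q * q) • (derivative R)^[n + 1] F =
          q • p • (Polynomial.derivative q • (derivative R)^[n] F +
            q • derivative R ((derivative R)^[n] F)) -
          (p * Polynomial.derivative q) • q • (derivative R)^[n] F := by
        rw [Function.iterate_succ_apply']
        simp only [smul_add, smul_smul]
        rw [show q * (p * Polynomial.derivative q) = p * Polynomial.derivative q * q by ring,
          show q * (p * q) = p * q * q by ring]
        abel
      rw [e]
      exact sub_mem h h'
  choose q hq hqN using key
  have : Module.Finite (Polynomial R) N := Module.Finite.iff_fg.2 hfg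
  have hdep : ¬ LinearIndependent (Polynomial R) fun n : ℕ => (⟨_, hqN n⟩ : N) := fun h =>
    not_finite_iff_infinite.2 inferInstance h.finite
  obtain ⟨s, g, hsum, i, hi, hgi⟩ := not_linearIndependent_iff.1 hdep
  have hs : ∀ j ∈ s, j < s.sup id + 1 := fun j hj =>
    Nat.lt_succ_of_le (Finset.le_sup (f := id) hj)
  refine ⟨s.sup id, fun j => if (j : ℕ) ∈ s then g j * q j else 0, ⟨⟨i, hs i hi⟩, ?_⟩, ?_⟩
  · simpa [hi] using ⟨hgi, hq i⟩
  · refine (Fin.sum_univ_eq_sum_range (fun j => ((if j ∈ s then g j * q j else 0 :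
      Polynomial R) : R⟦X⟧) * (derivative R)^[j] F) _).trans ?_
    refine Eq.trans ?_ (congrArg Subtype.val hsum)
    simp only [AddSubmonoidClass.coe_finsetSum, SetLike.val_smul, smul_smul]
    rw [← Finset.sum_subset (s₁ := s) fun j hj => Finset.mem_range.2 (hs j hj)]
    · refine Finset.sum_congr rfl fun j hj => ?_
      rw [if_pos hj, polynomial_smul_eq]
    · intro j _ hj
      simp [hj]

/-- A power series killed by a nontrivial polynomial differential operator lies in a holonomic
module. -/
lemma exists_isHolonomic_of_sum_eulerOp {F : R⟦X⟧} {c : ℕ → Polynomial R} {K : ℕ}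
    (hc : ∃ k < K, c k ≠ 0) (h : ∑ k ∈ Finset.range K, c k • (eulerOp R ^ k) F = 0) :
    ∃ N, IsHolonomic N ∧ F ∈ N := by
  induction K with
  | zero => simp at hc
  | succ K ih =>
    by_cases hK : c K = 0
    · rw [Finset.sum_range_succ, hK, zero_smul, add_zero] at h
      obtain ⟨k, hk, hck⟩ := hc
      refine ih ⟨k, lt_of_le_of_ne (Nat.le_of_lt_succ hk) ?_, hck⟩ h
      rintro rfl
      exact hck hK
    let s : Set R⟦X⟧ := (fun k => (eulerOp R ^ k) F) '' (Finset.range K : Set ℕ)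
    have hmem : ∀ k < K, (eulerOp R ^ k) F ∈ Submodule.span (Polynomial R) s := fun k hk =>
      Submodule.subset_span ⟨k, by simpa using hk, rfl⟩
    have hlast : c K • (eulerOp R ^ K) F ∈ Submodule.span (Polynomial R) s := by
      rw [Finset.sum_range_succ, add_eq_zero_iff_neg_eq] at h
      rw [← h]
      exact neg_mem (sum_mem fun k hk => Submodule.smul_mem _ _ (hmem k (Finset.mem_range.1 hk)))
    refine ⟨_, isHolonomic_span (s := s) ((Finset.finite_toSet _).image _)
      (mul_ne_zero hK Polynomial.X_ne_zero) ?_, ?_⟩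
    · rintro _ ⟨k, hk, rfl⟩
      have hk : k < K := by simpa using hk
      have e : (c K * Polynomial.X) • derivative R ((eulerOp R ^ k) F) =
          c K • (eulerOp R ^ (k + 1)) F := by
        rw [pow_succ', Module.End.mul_apply, eulerOp_apply, mul_smul, polynomial_smul_eq
          Polynomial.X, Polynomial.coe_X]
      change (c K * Polynomial.X) • derivative R ((eulerOp R ^ k) F) ∈ _
      rw [e]
      rcases (Nat.succ_le_of_lt hk).lt_or_eq with hk | hk
      · exact Submodule.smul_mem _ _ (hmem _ hk)
      · rw [← hk] at hlast; exact hk ▸ hlast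
    · rcases Nat.eq_zero_or_pos K with rfl | hK'
      · rw [zero_add, Finset.sum_range_one, pow_zero, Module.End.one_apply, polynomial_smul_eq]
          at h
        rw [(mul_eq_zero.1 h).resolve_left (by exact_mod_cast hK)]
        exact zero_mem _
      · simpa using hmem 0 hK'

/-- A power series with polynomially recursive coefficients lies in a holonomic module. -/
lemma exists_isHolonomic_of_recurrence {F : R⟦X⟧} {d : ℕ} {P : ℕ → Polynomial R}
    (hP : ∃ r ≤ d, P r ≠ 0)
    (h : ∀ n : ℕ, ∑ r ∈ Finset.range (d + 1), (P r).eval (n : R) * coeff (n + r) F = 0) :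
    ∃ N, IsHolonomic N ∧ F ∈ N := by
  let W : Polynomial R := ∏ k ∈ Finset.range d, (Polynomial.X + Polynomial.C ((k : R) + 1))
  have hW : W ≠ 0 := Finset.prod_ne_zero_iff.2 fun k _ => Polynomial.X_add_C_ne_zero _
  let Q : ℕ → Polynomial R := fun r => (P r * W).comp (Polynomial.X - Polynomial.C (r : R))
  have hQ : ∀ r, P r ≠ 0 → Q r ≠ 0 := fun r hr h0 => by
    have : (Q r).comp (Polynomial.X + Polynomial.C (r : R)) = P r * W := by
      simp [Q, Polynomial.comp_assoc]
    rw [h0, Polynomial.zero_comp] at this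
    exact mul_ne_zero hr hW this.symm
  have hsum : ∑ r ∈ Finset.range (d + 1),
      (X : R⟦X⟧) ^ (d - r) * Polynomial.aeval (eulerOp R) (Q r) F = 0 := by
    ext n
    rw [map_sum, map_zero]
    rcases le_or_gt d n with hn | hn
    · obtain ⟨m, rfl⟩ := Nat.exists_eq_add_of_le' hn
      rw [← mul_zero (W.eval (m : R)), ← h m, Finset.mul_sum]
      refine Finset.sum_congr rfl fun r hr => ?_
      have hr : r ≤ d := Nat.le_of_lt_succ (Finset.mem_range.1 hr)
      rw [coeff_X_pow_mul', if_pos (by omega), show m + d - (d - r) = m + r by omega,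
        coeff_aeval_eulerOp]
      simp [Q]
      ring
    · refine Finset.sum_eq_zero fun r hr => ?_
      have hr : r ≤ d := Nat.le_of_lt_succ (Finset.mem_range.1 hr)
      rw [coeff_X_pow_mul']
      split_ifs with hnr
      · obtain ⟨j, rfl⟩ : ∃ j, n = j + (d - r) := ⟨n - (d - r), by omega⟩
        have hWj : W.eval ((j : R) - r) = 0 := by
          rw [Polynomial.eval_prod]
          refine Finset.prod_eq_zero (i := r - j - 1) (Finset.mem_range.2 (by omega)) ?_
          have : ((r - j - 1 : ℕ) : R) + 1 = r - j := by
            rw [← Nat.cast_succ, ← Nat.cast_sub (by omega)]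
            congr 1
            omega
          simp [this]
        rw [Nat.add_sub_cancel, coeff_aeval_eulerOp]
        simp [Q, hWj]
      · rfl
  let K := (Finset.range (d + 1)).sup (fun r => (Q r).natDegree) + 1
  have hK : ∀ r ≤ d, (Q r).natDegree < K := fun r hr => Nat.lt_succ_of_le
    (Finset.le_sup (f := fun r => (Q r).natDegree) (Finset.mem_range.2 (Nat.lt_succ_of_le hr)))
  let c : ℕ → Polynomial R := fun k =>
    ∑ r ∈ Finset.range (d + 1), Polynomial.monomial (d - r) ((Q r).coeff k)
  refine exists_isHolonomic_of_sum_eulerOp (c := c) (K := K) ?_ ?_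
  · obtain ⟨r, hr, hPr⟩ := hP
    refine ⟨(Q r).natDegree, hK r hr, fun h0 => hQ r hPr ?_⟩
    have h1 := congrArg (fun p => Polynomial.coeff p (d - r)) h0
    simp only [c, Polynomial.finsetSum_coeff, Polynomial.coeff_monomial,
      Polynomial.coeff_zero] at h1
    rw [Finset.sum_eq_single r, if_pos rfl] at h1
    · exact Polynomial.leadingCoeff_eq_zero.1 h1
    · intro r' hr' hne
      have := Finset.mem_range.1 hr'
      rw [if_neg (by omega)]
    · intro h; exact absurd (Finset.mem_range.2 (Nat.lt_succ_of_le hr)) h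
  · rw [← hsum]
    simp only [c, Finset.sum_smul]
    rw [Finset.sum_comm]
    refine Finset.sum_congr rfl fun r hr => ?_
    rw [Polynomial.aeval_eq_sum_range' (hK r (Nat.le_of_lt_succ (Finset.mem_range.1 hr))),
      LinearMap.sum_apply, Finset.mul_sum]
    refine Finset.sum_congr rfl fun k _ => ?_
    rw [polynomial_smul_eq, Polynomial.coe_monomial, monomial_eq_C_mul_X_pow, LinearMap.smul_apply,
      smul_eq_C_mul]
    ring

end DFinite

section Assembly

variable {R : Type*} [CommRing R] [IsDomain R] [Algebra ℚ R]

lemma exists_isHolonomic_walkSeries (a : R) (ha : recCoeff₂ a 0 ≠ 0) :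
    ∃ N, IsHolonomic N ∧ walkSeries a 1 0 0 ∈ N := by
  let Y : Polynomial R := Polynomial.C (algebraMap ℚ R 3⁻¹) * Polynomial.X
  let P : ℕ → Polynomial R := fun r =>
    if r = 0 then recCoeff₀ (Polynomial.C a) Y else if r = 3 then recCoeff₁ (Polynomial.C a) Y
    else if r = 6 then recCoeff₂ (Polynomial.C a) Y else 0
  refine exists_isHolonomic_of_recurrence (d := 6) (P := P) ⟨6, le_rfl, fun h => ha ?_⟩ fun n => ?_
  · have h0 : Polynomial.evalRingHom (0 : R) (recCoeff₂ (Polynomial.C a) Y) = 0 := by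
      rw [show recCoeff₂ (Polynomial.C a) Y = 0 from h, map_zero]
    simpa only [map_recCoeff₂, Y, Polynomial.coe_evalRingHom, Polynomial.eval_C,
      Polynomial.eval_mul, Polynomial.eval_X, mul_zero] using h0
  · have hterm : ∀ r, ¬ 3 ∣ r → P r = 0 := fun r hr => by
      simp only [P]
      rw [if_neg (by omega), if_neg (by omega), if_neg (by omega)]
    simp only [Finset.sum_range_succ, Finset.sum_range_zero, hterm 1 (by omega),
      hterm 2 (by omega), hterm 4 (by omega), hterm 5 (by omega), Polynomial.eval_zero, zero_mul,
      add_zero, zero_add, walkSeries, coeff_mk]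
    by_cases hn : 3 ∣ n
    · obtain ⟨m, rfl⟩ := hn
      have hY : Polynomial.evalRingHom ((3 * m : ℕ) : R) Y = m := by
        have h3 : algebraMap ℚ R 3⁻¹ * 3 = 1 := by
          rw [← map_ofNat (algebraMap ℚ R) 3, ← map_mul]
          norm_num
        simp only [Y, Polynomial.coe_evalRingHom, Polynomial.eval_mul, Polynomial.eval_C,
          Polynomial.eval_X]
        push_cast
        rw [← mul_assoc, h3, one_mul]
      have hC : Polynomial.evalRingHom ((3 * m : ℕ) : R) (Polynomial.C a) = a := by simp
      have h := walkWeight_recurrence a m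
      rw [← hY] at h
      nth_rewrite 1 3 5 [← hC] at h
      rw [← map_recCoeff₀, ← map_recCoeff₁, ← map_recCoeff₂] at h
      exact h
    · rw [walkWeight_eq_zero_of_mod, walkWeight_eq_zero_of_mod, walkWeight_eq_zero_of_mod]
      · simp
      all_goals omega

end Assembly

/-- Model 17: `G(t;a,b)` is a ratio of D-finite series. -/
theorem model17_Gab_ratio_of_dfinite :
    ∃ F H : PowerSeries (MvPolynomial (Fin 2) ℚ),
      IsDFinite F ∧ IsDFinite H ∧ H ≠ 0 ∧
      H * loopGF ({((0:ℤ), (1:ℤ)), (-1, 0), (1, -1)} : Set (ℤ × ℤ))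
        (MvPolynomial.X (0 : Fin 2)) (MvPolynomial.X (1 : Fin 2)) = F := by
  have hX : ∀ i : Fin 2, recCoeff₂ (MvPolynomial.X i : MvPolynomial (Fin 2) ℚ) 0 ≠ 0 := by
    intro i h
    have := congrArg (MvPolynomial.eval (0 : Fin 2 → ℚ)) h
    rw [map_recCoeff₂, MvPolynomial.eval_X, map_zero, Pi.zero_apply] at this
    norm_num [recCoeff₂] at this
  obtain ⟨M, hM, haM⟩ := exists_isHolonomic_walkSeries _ (hX 0)
  obtain ⟨N, hN, hbN⟩ := exists_isHolonomic_walkSeries _ (hX 1)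
  set a : MvPolynomial (Fin 2) ℚ := MvPolynomial.X 0 with ha
  set b : MvPolynomial (Fin 2) ℚ := MvPolynomial.X 1 with hb
  have hG : loopGF ({((0:ℤ), (1:ℤ)), (-1, 0), (1, -1)} : Set (ℤ × ℤ)) a b = walkSeries a b 0 0 := by
    ext1 n
    rw [coeff_loopGF, walkSeries, coeff_mk]
  let U := Submodule.span (Polynomial (MvPolynomial (Fin 2) ℚ)) {(1 : (MvPolynomial (Fin 2) ℚ)⟦X⟧)}
  have hU : IsHolonomic (U ⊔ M ⊔ N) := (isHolonomic_span_one.sup hM).sup hN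
  have hcomb : ∀ p q r : Polynomial (MvPolynomial (Fin 2) ℚ),
      IsDFinite ((p : (MvPolynomial (Fin 2) ℚ)⟦X⟧) +
        (q : (MvPolynomial (Fin 2) ℚ)⟦X⟧) * walkSeries a 1 0 0 +
        (r : (MvPolynomial (Fin 2) ℚ)⟦X⟧) * walkSeries b 1 0 0) := fun p q r => by
    refine hU.isDFinite (add_mem (Submodule.mem_sup_left (add_mem (Submodule.mem_sup_left ?_)
      (Submodule.mem_sup_right ?_))) (Submodule.mem_sup_right ?_))
    · rw [← mul_one (p : (MvPolynomial (Fin 2) ℚ)⟦X⟧), ← polynomial_smul_eq]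
      exact U.smul_mem p (Submodule.mem_span_singleton_self 1)
    · rw [← polynomial_smul_eq]
      exact M.smul_mem q haM
    · rw [← polynomial_smul_eq]
      exact N.smul_mem r hbN
  refine ⟨_, _, ?_, ?_, ?_, (mul_comm _ _).trans (hG ▸ walkSeries_relation a b)⟩
  · convert hcomb (-(Polynomial.C ((a - 1) * (b - 1) * (b - a))))
      (-(Polynomial.C (a ^ 2 * b ^ 2 * (a - 1)) * Polynomial.X ^ 3))
      (Polynomial.C (a ^ 2 * b ^ 2 * (b - 1)) * Polynomial.X ^ 3) using 1
    simp only [Polynomial.coe_neg, Polynomial.coe_sub, Polynomial.coe_mul, Polynomial.coe_C,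
      Polynomial.coe_pow, Polynomial.coe_X, Polynomial.coe_one, map_mul, map_sub, map_pow, map_one]
    ring
  · convert hcomb (Polynomial.C ((b - a) * a ^ 2 * b ^ 2) * Polynomial.X ^ 3
        - Polynomial.C ((a - 1) * (b - 1) * (b - a)))
      (-(Polynomial.C (a ^ 2 * b ^ 2 * (a - 1) ^ 2 * (b - 1)) * Polynomial.X ^ 3))
      (Polynomial.C (a ^ 2 * b ^ 2 * (b - 1) ^ 2 * (a - 1)) * Polynomial.X ^ 3) using 1
    simp only [Polynomial.coe_neg, Polynomial.coe_sub, Polynomial.coe_mul, Polynomial.coe_C,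
      Polynomial.coe_pow, Polynomial.coe_X, Polynomial.coe_one, map_mul, map_sub, map_pow, map_one]
    ring
  · intro h
    have h' := congrArg (fun f => MvPolynomial.eval ![2, 3] (constantCoeff f)) h
    norm_num [ha, hb] at h'
end
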